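/- arXiv:1610.06656 — 7 statements merged into one kernel-verified Lean document; each statement's English description precedes it below -/
import Mathlib

section
/- Let 0 < ε < 1/2 and let a, b ∈ R^d and ã, b̃ ∈ R^k be nonzero vectors such that 1−ε ≤ ‖a‖/‖ã‖ ≤ 1+ε, 1−ε ≤ ‖b‖/‖b̃‖ ≤ 1+ε, and |⟨ã, b̃⟩ − ⟨a, b⟩| ≤ ε·‖a‖·‖b‖. Then the rescaled estimate satisfies | ‖a‖·‖b‖·⟨ã, b̃⟩/(‖ã‖·‖b̃‖) − ⟨a, b⟩ | ≤ 7ε·‖a‖·‖b‖. -/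
open scoped RealInnerProductSpace

theorem stmt1 {d k : ℕ} (ε : ℝ) (hε : 0 < ε) (hε' : ε < 1 / 2)
    (a b : EuclideanSpace ℝ (Fin d)) (ta tb : EuclideanSpace ℝ (Fin k))
    (ha : a ≠ 0) (hb : b ≠ 0) (hta : ta ≠ 0) (htb : tb ≠ 0)
    (hna : 1 - ε ≤ ‖a‖ / ‖ta‖) (hna' : ‖a‖ / ‖ta‖ ≤ 1 + ε)
    (hnb : 1 - ε ≤ ‖b‖ / ‖tb‖) (hnb' : ‖b‖ / ‖tb‖ ≤ 1 + ε)
    (hip : |⟪ta, tb⟫ - ⟪a, b⟫| ≤ ε * ‖a‖ * ‖b‖) :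
    |‖a‖ * ‖b‖ * ⟪ta, tb⟫ / (‖ta‖ * ‖tb‖) - ⟪a, b⟫| ≤ 7 * ε * ‖a‖ * ‖b‖ := by
  set r := ‖a‖ / ‖ta‖ with hr
  set s := ‖b‖ / ‖tb‖ with hs
  set N := ‖a‖ * ‖b‖ with hN
  have hN0 : 0 ≤ N := by positivity
  have hI : |⟪a, b⟫| ≤ N := abs_real_inner_le_norm a b
  have hr0 : 0 ≤ r := by positivity
  have hs0 : 0 ≤ s := by positivity
  have hscale : N * ⟪ta, tb⟫ / (‖ta‖ * ‖tb‖) = r * s * ⟪ta, tb⟫ := by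
    rw [hN, hr, hs, div_mul_div_comm, div_mul_eq_mul_div]
  have hupper : r * s ≤ 1 + 5 / 2 * ε := by
    have := mul_le_mul hna' hnb' hs0 (by linarith)
    nlinarith
  have hlower : 1 - 2 * ε ≤ r * s := by
    have := mul_le_mul hna hnb (by linarith) hr0
    nlinarith
  have hdev : |r * s - 1| ≤ 5 / 2 * ε := by
    rw [abs_le]
    constructor <;> linarith
  have hip' : |⟪ta, tb⟫ - ⟪a, b⟫| ≤ ε * N := by rwa [hN, ← mul_assoc]
  calc |N * ⟪ta, tb⟫ / (‖ta‖ * ‖tb‖) - ⟪a, b⟫|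
      = |r * s * (⟪ta, tb⟫ - ⟪a, b⟫) + (r * s - 1) * ⟪a, b⟫| := by
        rw [hscale]
        ring_nf
    _ ≤ r * s * |⟪ta, tb⟫ - ⟪a, b⟫| + |r * s - 1| * |⟪a, b⟫| := by
        refine (abs_add_le _ _).trans_eq ?_
        rw [abs_mul, abs_mul (r * s - 1), abs_of_nonneg (mul_nonneg hr0 hs0)]
    _ ≤ 9 / 4 * (ε * N) + 5 / 2 * ε * N := by
        gcongr
        linarith
    _ ≤ 7 * ε * ‖a‖ * ‖b‖ := by
        rw [mul_assoc (7 * ε), ← hN]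
        nlinarith [mul_nonneg hε.le hN0]
end

section
/- Let 0 < ε < 1/2. Let A, B be real d×n matrices, let Ã, B̃ be real k×n matrices with ‖Ã^T B̃ − A^T B‖ ≤ ε·‖A‖·‖B‖ (spectral norm), and let D_A, D_B be diagonal n×n matrices whose diagonal entries all lie in the interval [1−ε, 1+ε]. Then ‖D_A Ã^T B̃ D_B − A^T B‖ ≤ 7ε·‖A‖·‖B‖. -/
open MeasureTheory ProbabilityTheory Matrix
open scoped NNReal ENNReal

noncomputable def cnorm {d n : ℕ} (A : Matrix (Fin d) (Fin n) ℝ) (i : Fin n) : ℝ :=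
  Real.sqrt (∑ r, (A r i) ^ 2)

noncomputable def frobNorm {d n : ℕ} (A : Matrix (Fin d) (Fin n) ℝ) : ℝ :=
  Real.sqrt (∑ r, ∑ i, (A r i) ^ 2)

noncomputable def specNorm {m n : ℕ} (A : Matrix (Fin m) (Fin n) ℝ) : ℝ :=
  ‖LinearMap.toContinuousLinearMap (Matrix.toEuclideanLin A)‖

/-- The distribution of a k×d random matrix with i.i.d. N(0, 1/k) entries. -/
noncomputable def gaussianMatrix (k d : ℕ) : Measure (Fin k → Fin d → ℝ) :=
  Measure.pi fun _ : Fin k => Measure.pi fun _ : Fin d => gaussianReal 0 (k : ℝ≥0)⁻¹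

/-- The rescaled-JL estimator M̃(i,j) = ‖A_i‖·‖B_j‖·(Ã_i^T B̃_j)/(‖Ã_i‖·‖B̃_j‖),
where Ã = ΠA and B̃ = ΠB. -/
noncomputable def rescaledJL {k d n : ℕ} (P : Fin k → Fin d → ℝ)
    (A B : Matrix (Fin d) (Fin n) ℝ) : Matrix (Fin n) (Fin n) ℝ :=
  Matrix.of fun i j =>
    cnorm A i * cnorm B j * (((Matrix.of P * A)ᵀ * (Matrix.of P * B)) i j) /
      (cnorm (Matrix.of P * A) i * cnorm (Matrix.of P * B) j)


open scoped Matrix.Norms.L2Operator in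
theorem specNorm_eq_l2_opNorm {m n : ℕ} (A : Matrix (Fin m) (Fin n) ℝ) : specNorm A = ‖A‖ :=
  (Matrix.l2_opNorm_def A).symm

open scoped Matrix.Norms.L2Operator in
theorem l2_opNorm_diagonal_le {n : ℕ} {v : Fin n → ℝ} {c : ℝ} (hc : 0 ≤ c)
    (hv : ∀ i, |v i| ≤ c) : ‖Matrix.diagonal v‖ ≤ c := by
  rw [Matrix.l2_opNorm_diagonal]
  exact (pi_norm_le_iff_of_nonneg hc).2 hv

open scoped Matrix.Norms.L2Operator in
/-- Perturbation bound for two-sided diagonal rescaling of an approximation `M` of `N`. -/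
theorem l2_opNorm_diagonal_mul_mul_diagonal_sub_le {n : ℕ} {ε : ℝ} (hε : 0 ≤ ε)
    (M N : Matrix (Fin n) (Fin n) ℝ) {v w : Fin n → ℝ}
    (hv : ∀ i, |v i - 1| ≤ ε) (hw : ∀ i, |w i - 1| ≤ ε) :
    ‖Matrix.diagonal v * M * Matrix.diagonal w - N‖ ≤
      (1 + ε) ^ 2 * ‖M - N‖ + ε * (2 + ε) * ‖N‖ := by
  have key : ∀ u : Fin n → ℝ, (∀ i, |u i - 1| ≤ ε) →
      ‖Matrix.diagonal u‖ ≤ 1 + ε ∧ ‖Matrix.diagonal u - 1‖ ≤ ε := by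
    intro u hu
    refine ⟨l2_opNorm_diagonal_le (by linarith) fun i => ?_, ?_⟩
    · have := abs_le.1 (hu i)
      rw [abs_le]
      constructor <;> linarith
    · rw [← Matrix.diagonal_one, Matrix.diagonal_sub]
      exact l2_opNorm_diagonal_le hε hu
  obtain ⟨hV, hV'⟩ := key v hv
  obtain ⟨hW, hW'⟩ := key w hw
  set V := Matrix.diagonal v
  set W := Matrix.diagonal w
  have e : V * M * W - N = V * (M - N) * W + ((V - 1) * N * W + N * (W - 1)) := by
    noncomm_ring
  have h1 : ‖V * (M - N) * W‖ ≤ (1 + ε) * ‖M - N‖ * (1 + ε) := by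
    refine (norm_mul_le _ _).trans ?_
    gcongr
    exact (norm_mul_le _ _).trans (by gcongr)
  have h2 : ‖(V - 1) * N * W‖ ≤ ε * ‖N‖ * (1 + ε) := by
    refine (norm_mul_le _ _).trans ?_
    gcongr
    exact (norm_mul_le _ _).trans (by gcongr)
  have h3 : ‖N * (W - 1)‖ ≤ ‖N‖ * ε := (norm_mul_le _ _).trans (by gcongr)
  rw [e]
  refine (norm_add_le _ _).trans ?_
  have := norm_add_le ((V - 1) * N * W) (N * (W - 1))
  linarith

open scoped Matrix.Norms.L2Operator in
theorem l2_opNorm_transpose_mul_le {d n : ℕ} (A B : Matrix (Fin d) (Fin n) ℝ) :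
    ‖Aᵀ * B‖ ≤ ‖A‖ * ‖B‖ := by
  have hA : ‖Aᵀ‖ = ‖A‖ := by
    rw [← Matrix.conjTranspose_eq_transpose_of_trivial, Matrix.l2_opNorm_conjTranspose]
  exact (Matrix.l2_opNorm_mul _ _).trans_eq (by rw [hA])

theorem stmt3 {d k n : ℕ} (ε : ℝ) (hε : 0 < ε) (hε' : ε < 1 / 2)
    (A B : Matrix (Fin d) (Fin n) ℝ) (tA tB : Matrix (Fin k) (Fin n) ℝ)
    (dA dB : Fin n → ℝ)
    (hdA : ∀ i, 1 - ε ≤ dA i ∧ dA i ≤ 1 + ε)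
    (hdB : ∀ j, 1 - ε ≤ dB j ∧ dB j ≤ 1 + ε)
    (h : specNorm (tAᵀ * tB - Aᵀ * B) ≤ ε * specNorm A * specNorm B) :
    specNorm (Matrix.diagonal dA * (tAᵀ * tB) * Matrix.diagonal dB - Aᵀ * B) ≤
      7 * ε * specNorm A * specNorm B := by
  have hN : specNorm (Aᵀ * B) ≤ specNorm A * specNorm B := by
    simpa only [specNorm_eq_l2_opNorm] using l2_opNorm_transpose_mul_le A B
  have hsub : ∀ u : Fin n → ℝ, (∀ i, 1 - ε ≤ u i ∧ u i ≤ 1 + ε) → ∀ i, |u i - 1| ≤ ε := by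
    intro u hu i
    rw [abs_le]
    constructor <;> linarith [(hu i).1, (hu i).2]
  have hP := l2_opNorm_diagonal_mul_mul_diagonal_sub_le hε.le (tAᵀ * tB) (Aᵀ * B)
    (hsub dA hdA) (hsub dB hdB)
  simp only [← specNorm_eq_l2_opNorm] at hP
  have hp : 0 ≤ specNorm A * specNorm B := mul_nonneg (norm_nonneg _) (norm_nonneg _)
  calc specNorm (Matrix.diagonal dA * (tAᵀ * tB) * Matrix.diagonal dB - Aᵀ * B)
      ≤ (1 + ε) ^ 2 * specNorm (tAᵀ * tB - Aᵀ * B) + ε * (2 + ε) * specNorm (Aᵀ * B) := hP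
    _ ≤ (1 + ε) ^ 2 * (ε * specNorm A * specNorm B)
        + ε * (2 + ε) * (specNorm A * specNorm B) := by gcongr
    _ = ((1 + ε) ^ 2 + (2 + ε)) * (ε * (specNorm A * specNorm B)) := by ring
    _ ≤ 7 * (ε * (specNorm A * specNorm B)) := by
        gcongr
        nlinarith
    _ = 7 * ε * specNorm A * specNorm B := by ring
end

section
/- Let 0 < ε < 1/14 and 0 < δ < 1, and let A, B be nonzero real d×n matrices all of whose columns are nonzero. Let r̃ = max{‖A‖_F²/‖A‖², ‖B‖_F²/‖B‖²} be the maximum stable rank. There exists an absolute constant C > 0 such that if k ≥ C·(r̃ + log(n/δ))/ε², then with probability at least 1−δ over the random sketching matrix Π, the rescaled-JL estimator satisfies ‖M̃ − A^T B‖ ≤ ε·‖A‖·‖B‖ in spectral norm. -/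
open MeasureTheory ProbabilityTheory Matrix
open scoped NNReal ENNReal

theorem lintegral_pi_prod {ι : Type*} [Fintype ι] {α : ι → Type*} [∀ i, MeasurableSpace (α i)]
    (μ : ∀ i, Measure (α i)) [∀ i, IsProbabilityMeasure (μ i)] {f : ∀ i, α i → ℝ≥0∞}
    (hf : ∀ i, Measurable (f i)) :
    ∫⁻ x, ∏ i, f i (x i) ∂(Measure.pi μ) = ∏ i, ∫⁻ y, f i y ∂(μ i) := by
  rw [lintegral_prod_eq_prod_lintegral_of_indepFun Finset.univ
    (fun i (x : ∀ i, α i) => f i (x i))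
    (iIndepFun_pi fun i => (hf i).aemeasurable) fun i => (hf i).comp (measurable_pi_apply i)]
  refine Finset.prod_congr rfl fun i _ => ?_
  rw [← (measurePreserving_eval μ i).lintegral_comp (hf i)]

theorem map_dotProduct_pi_gaussianReal {ι : Type*} [Fintype ι] (v : ℝ≥0) (x : ι → ℝ) :
    (Measure.pi fun _ : ι => gaussianReal 0 v).map (fun g => g ⬝ᵥ x)
      = gaussianReal 0 (v * (x ⬝ᵥ x).toNNReal) := by
  have hm : Measurable fun g : ι → ℝ => g ⬝ᵥ x := by
    unfold dotProduct; fun_prop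
  have : IsProbabilityMeasure ((Measure.pi fun _ : ι => gaussianReal 0 v).map
      (fun g => g ⬝ᵥ x)) := Measure.isProbabilityMeasure_map hm.aemeasurable
  refine Measure.ext_of_charFun ?_
  funext t
  have hx : 0 ≤ x ⬝ᵥ x := Finset.sum_nonneg fun i _ => mul_self_nonneg _
  rw [charFun_apply_real, integral_map hm.aemeasurable (by fun_prop), charFun_gaussianReal]
  have h1 : ∀ g : ι → ℝ, Complex.exp (t * ((g ⬝ᵥ x : ℝ) : ℂ) * Complex.I)
      = ∏ i, Complex.exp (((t * x i : ℝ) : ℂ) * (g i : ℂ) * Complex.I) := by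
    intro g
    rw [← Complex.exp_sum]
    congr 1
    simp only [dotProduct]
    push_cast
    rw [Finset.mul_sum, Finset.sum_mul]
    exact Finset.sum_congr rfl fun i _ => by ring
  simp_rw [h1]
  rw [integral_fintype_prod_eq_prod
    (fun i (y : ℝ) => Complex.exp (((t * x i : ℝ) : ℂ) * (y : ℂ) * Complex.I))]
  simp_rw [← charFun_apply_real, charFun_gaussianReal]
  rw [← Complex.exp_sum]
  congr 1
  have h2 : (((v * (x ⬝ᵥ x).toNNReal : ℝ≥0) : ℝ) : ℂ) = v * ∑ i, (x i : ℂ) * x i := by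
    rw [NNReal.coe_mul, Real.coe_toNNReal _ hx]
    simp [dotProduct]
  rw [show (((v * (x ⬝ᵥ x).toNNReal : ℝ≥0)) : ℂ) = v * ∑ i, (x i : ℂ) * x i from h2]
  simp only [Complex.ofReal_zero, mul_zero, zero_mul, zero_sub, Finset.mul_sum, Finset.sum_mul,
    Finset.sum_div, Finset.sum_neg_distrib]
  congr 1
  refine Finset.sum_congr rfl fun i _ => ?_
  push_cast
  ring

theorem one_le_one_sub_mul_exp {y : ℝ} (hy : |y| ≤ 1 / 2) :
    1 ≤ (1 - y) * Real.exp (y + y ^ 2) := by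
  obtain ⟨h1, h2⟩ := abs_le.mp hy
  rcases le_total 0 y with h | h
  · have := Real.quadratic_le_exp_of_nonneg (x := y + y ^ 2) (by positivity)
    have h3 : (1 - y) * (1 + (y + y ^ 2) + (y + y ^ 2) ^ 2 / 2) ≤
        (1 - y) * Real.exp (y + y ^ 2) := by gcongr; linarith
    refine le_trans ?_ h3
    have : 0 ≤ y ^ 2 * ((1 - y) * (1 + y) ^ 2 - 2 * y) := by
      refine mul_nonneg (sq_nonneg _) ?_
      nlinarith [mul_nonneg h h, mul_nonneg h (sub_nonneg.2 h2),
        mul_nonneg (mul_nonneg h h) (sub_nonneg.2 h2)]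
    nlinarith
  · have := Real.add_one_le_exp (y + y ^ 2)
    have h3 : (1 - y) * (y + y ^ 2 + 1) ≤ (1 - y) * Real.exp (y + y ^ 2) := by gcongr; linarith
    refine le_trans ?_ h3
    nlinarith [mul_nonneg (neg_nonneg.2 h) (sq_nonneg y)]

theorem lintegral_exp_mul_sq_gaussianReal_le {v : ℝ≥0} {s : ℝ} (h : |s| * v ≤ 1 / 4) :
    ∫⁻ z, ENNReal.ofReal (Real.exp (s * z ^ 2)) ∂(gaussianReal 0 v)
      ≤ ENNReal.ofReal (Real.exp (s * v + 2 * s ^ 2 * v ^ 2)) := by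
  by_cases hv : v = 0
  · subst hv
    rw [gaussianReal_zero_var, lintegral_dirac']
    · simp
    · fun_prop
  have hvp : (0 : ℝ) < v := by positivity
  have hs : |2 * (s * v)| ≤ 1 / 2 := by
    rw [abs_mul, abs_mul, abs_of_pos hvp]; norm_num; linarith
  have hs' := abs_le.mp hs
  have hb : 0 < 1 / (2 * v) - s := by
    rw [sub_pos, lt_div_iff₀ (by positivity)]; linarith
  rw [gaussianReal_of_var_ne_zero _ hv, lintegral_withDensity_eq_lintegral_mul _
    (measurable_gaussianPDF _ _) (by fun_prop)]
  have h1 : ∀ z : ℝ, (gaussianPDF 0 v * fun z => ENNReal.ofReal (Real.exp (s * z ^ 2))) z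
      = ENNReal.ofReal ((√(2 * Real.pi * v))⁻¹ * Real.exp (-(1 / (2 * v) - s) * z ^ 2)) := by
    intro z
    rw [Pi.mul_apply, gaussianPDF, ← ENNReal.ofReal_mul (gaussianPDFReal_nonneg _ _ _),
      gaussianPDFReal, mul_assoc, ← Real.exp_add]
    congr 3
    field_simp
    ring
  simp_rw [h1]
  rw [← ofReal_integral_eq_lintegral_ofReal
    ((integrable_exp_neg_mul_sq hb).const_mul _)
    (Filter.Eventually.of_forall fun z => by positivity), integral_const_mul, integral_gaussian]
  refine ENNReal.ofReal_le_ofReal ?_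
  have h2 : (√(2 * Real.pi * v))⁻¹ * √(Real.pi / (1 / (2 * v) - s))
      = √((1 - 2 * (s * v))⁻¹) := by
    rw [← Real.sqrt_inv, ← Real.sqrt_mul (by positivity)]
    congr 1
    have : (1 - 2 * (s * v) : ℝ) ≠ 0 := by linarith
    field_simp
  rw [h2, Real.sqrt_le_left (Real.exp_pos _).le, ← Real.exp_nat_mul, inv_le_iff_one_le_mul₀
    (by linarith), mul_comm]
  refine (one_le_one_sub_mul_exp hs).trans_eq ?_
  congr 2
  push_cast
  ring

theorem measurable_mulVec {m n : ℕ} (x : Fin n → ℝ) :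
    Measurable fun P : Fin m → Fin n → ℝ => Matrix.of P *ᵥ x := by
  unfold Matrix.mulVec dotProduct
  simp only [of_apply]
  fun_prop

theorem lintegral_exp_gaussianMatrix_le {k d : ℕ} (hk : 0 < k) (x : Fin d → ℝ) {s : ℝ}
    (h : |s| * (x ⬝ᵥ x) ≤ k / 4) :
    ∫⁻ P, ENNReal.ofReal (Real.exp
        (s * ((Matrix.of P *ᵥ x) ⬝ᵥ (Matrix.of P *ᵥ x) - x ⬝ᵥ x))) ∂(gaussianMatrix k d)
      ≤ ENNReal.ofReal (Real.exp (2 * s ^ 2 * (x ⬝ᵥ x) ^ 2 / k)) := by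
  have hk' : (0 : ℝ) < k := by exact_mod_cast hk
  have hx : 0 ≤ x ⬝ᵥ x := Finset.sum_nonneg fun i _ => mul_self_nonneg _
  have hm : Measurable fun g : Fin d → ℝ => g ⬝ᵥ x := by unfold dotProduct; fun_prop
  have h1 : ∀ P : Fin k → Fin d → ℝ, ENNReal.ofReal (Real.exp
        (s * ((Matrix.of P *ᵥ x) ⬝ᵥ (Matrix.of P *ᵥ x) - x ⬝ᵥ x)))
      = ENNReal.ofReal (Real.exp (-(s * (x ⬝ᵥ x)))) *
        ∏ i, ENNReal.ofReal (Real.exp (s * (P i ⬝ᵥ x) ^ 2)) := by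
    intro P
    rw [← ENNReal.ofReal_prod_of_nonneg fun i _ => (Real.exp_pos _).le, ← Real.exp_sum,
      ← ENNReal.ofReal_mul (Real.exp_pos _).le, ← Real.exp_add, mul_sub, ← Finset.mul_sum]
    congr 2
    have : (Matrix.of P *ᵥ x) ⬝ᵥ (Matrix.of P *ᵥ x) = ∑ i, (P i ⬝ᵥ x) ^ 2 :=
      Finset.sum_congr rfl fun i _ => (sq _).symm
    rw [this]
    ring
  simp_rw [h1]
  rw [lintegral_const_mul' _ _ ENNReal.ofReal_ne_top, gaussianMatrix,
    lintegral_pi_prod _ (f := fun _ g => ENNReal.ofReal (Real.exp (s * (g ⬝ᵥ x) ^ 2)))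
      (fun _ => by fun_prop)]
  rw [Finset.prod_const, Finset.card_univ, Fintype.card_fin]
  have h2 : ∫⁻ g, ENNReal.ofReal (Real.exp (s * (g ⬝ᵥ x) ^ 2))
      ∂(Measure.pi fun _ : Fin d => gaussianReal 0 (k : ℝ≥0)⁻¹)
      ≤ ENNReal.ofReal (Real.exp (s * (x ⬝ᵥ x) / k + 2 * s ^ 2 * (x ⬝ᵥ x) ^ 2 / k ^ 2)) := by
    rw [← lintegral_map (μ := Measure.pi fun _ : Fin d => gaussianReal 0 (k : ℝ≥0)⁻¹)
      (f := fun z => ENNReal.ofReal (Real.exp (s * z ^ 2))) (by fun_prop) hm,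
      map_dotProduct_pi_gaussianReal]
    have hv : (((k : ℝ≥0)⁻¹ * (x ⬝ᵥ x).toNNReal : ℝ≥0) : ℝ) = (x ⬝ᵥ x) / k := by
      rw [NNReal.coe_mul, Real.coe_toNNReal _ hx]; push_cast; field_simp
    refine (lintegral_exp_mul_sq_gaussianReal_le ?_).trans_eq ?_
    · rw [hv, ← mul_div_assoc, div_le_iff₀ hk']; linarith
    · rw [hv]; congr 2; field_simp
  calc _ ≤ ENNReal.ofReal (Real.exp (-(s * (x ⬝ᵥ x)))) * ENNReal.ofReal
        (Real.exp (s * (x ⬝ᵥ x) / k + 2 * s ^ 2 * (x ⬝ᵥ x) ^ 2 / k ^ 2)) ^ k := by gcongr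
    _ = _ := by
      rw [← ENNReal.ofReal_pow (Real.exp_pos _).le, ← ENNReal.ofReal_mul (Real.exp_pos _).le,
        ← Real.exp_nat_mul, ← Real.exp_add]
      congr 2
      field_simp
      ring

theorem lintegral_exp_bilin_gaussianMatrix_le {k d : ℕ} (hk : 0 < k) (a b : Fin d → ℝ)
    (ha : a ⬝ᵥ a ≤ 4) (hb : b ⬝ᵥ b ≤ 4) {l : ℝ} (hl : 0 ≤ l) (hlk : l ≤ k / 32) :
    ∫⁻ P, ENNReal.ofReal (Real.exp
        (l * ((Matrix.of P *ᵥ a) ⬝ᵥ (Matrix.of P *ᵥ b) - a ⬝ᵥ b))) ∂(gaussianMatrix k d)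
      ≤ ENNReal.ofReal (Real.exp (128 * l ^ 2 / k)) := by
  have hpar : (a + b) ⬝ᵥ (a + b) + (a - b) ⬝ᵥ (a - b) = 2 * (a ⬝ᵥ a) + 2 * (b ⬝ᵥ b) := by
    simp only [add_dotProduct, dotProduct_add, sub_dotProduct, dotProduct_sub]; ring
  have hp : 0 ≤ (a + b) ⬝ᵥ (a + b) := Finset.sum_nonneg fun i _ => mul_self_nonneg _
  have hq : 0 ≤ (a - b) ⬝ᵥ (a - b) := Finset.sum_nonneg fun i _ => mul_self_nonneg _
  have hp' : (a + b) ⬝ᵥ (a + b) ≤ 16 := by linarith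
  have hq' : (a - b) ⬝ᵥ (a - b) ≤ 16 := by linarith
  set G : (Fin k → Fin d → ℝ) → (Fin d → ℝ) → ℝ := fun P x =>
    (Matrix.of P *ᵥ x) ⬝ᵥ (Matrix.of P *ᵥ x) - x ⬝ᵥ x with hG
  have h1 : ∀ P : Fin k → Fin d → ℝ, ENNReal.ofReal (Real.exp
        (l * ((Matrix.of P *ᵥ a) ⬝ᵥ (Matrix.of P *ᵥ b) - a ⬝ᵥ b)))
      ≤ ENNReal.ofReal (1 / 2) * (ENNReal.ofReal (Real.exp (l / 2 * G P (a + b))) +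
        ENNReal.ofReal (Real.exp (-(l / 2) * G P (a - b)))) := by
    intro P
    rw [← ENNReal.ofReal_add (Real.exp_pos _).le (Real.exp_pos _).le,
      ← ENNReal.ofReal_mul (by norm_num)]
    refine ENNReal.ofReal_le_ofReal ?_
    have e : l * ((Matrix.of P *ᵥ a) ⬝ᵥ (Matrix.of P *ᵥ b) - a ⬝ᵥ b)
        = (l / 2 * G P (a + b)) / 2 + (-(l / 2) * G P (a - b)) / 2 := by
      simp only [hG, mulVec_add, mulVec_sub, add_dotProduct, dotProduct_add, sub_dotProduct,
        dotProduct_sub]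
      rw [dotProduct_comm b a, dotProduct_comm (Matrix.of P *ᵥ b) (Matrix.of P *ᵥ a)]
      ring
    rw [e, Real.exp_add]
    set X := l / 2 * G P (a + b)
    set Y := -(l / 2) * G P (a - b)
    have hX : Real.exp X = Real.exp (X / 2) ^ 2 := by
      rw [← Real.exp_nat_mul]; congr 1; push_cast; ring
    have hY : Real.exp Y = Real.exp (Y / 2) ^ 2 := by
      rw [← Real.exp_nat_mul]; congr 1; push_cast; ring
    rw [hX, hY]
    nlinarith [sq_nonneg (Real.exp (X / 2) - Real.exp (Y / 2))]
  have hmG : ∀ x, Measurable fun P => G P x := by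
    intro x
    have := measurable_mulVec (m := k) x
    simp only [hG]
    unfold dotProduct
    fun_prop
  have key : ∀ (x : Fin d → ℝ) (s : ℝ), 0 ≤ x ⬝ᵥ x → x ⬝ᵥ x ≤ 16 → |s| = l / 2 →
      ∫⁻ P, ENNReal.ofReal (Real.exp (s * G P x)) ∂(gaussianMatrix k d)
        ≤ ENNReal.ofReal (Real.exp (128 * l ^ 2 / k)) := by
    intro x s h0 h16 hs
    refine (lintegral_exp_gaussianMatrix_le hk x (by rw [hs]; nlinarith)).trans ?_
    refine ENNReal.ofReal_le_ofReal (Real.exp_le_exp.2 ?_)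
    refine div_le_div_of_nonneg_right ?_ (Nat.cast_nonneg k)
    have : s ^ 2 = l ^ 2 / 4 := by rw [← sq_abs, hs]; ring
    rw [this]
    nlinarith [sq_nonneg l, mul_nonneg h0 (sub_nonneg.2 h16),
      mul_nonneg (sq_nonneg l) (mul_nonneg h0 (sub_nonneg.2 h16)),
      mul_nonneg (sq_nonneg l) (sub_nonneg.2 h16)]
  refine (lintegral_mono h1).trans ?_
  rw [lintegral_const_mul' _ _ ENNReal.ofReal_ne_top,
    lintegral_add_left (by have := hmG (a + b); fun_prop)]
  refine (mul_le_mul_right (add_le_add (key _ _ hp hp' (abs_of_nonneg (by positivity)))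
    (key _ _ hq hq' (by rw [abs_neg, abs_of_nonneg (by positivity)]))) _).trans_eq ?_
  rw [← ENNReal.ofReal_add (Real.exp_pos _).le (Real.exp_pos _).le,
      ← ENNReal.ofReal_mul (by norm_num)]
  congr 1
  ring

theorem lintegral_gaussianReal_shift {v : ℝ≥0} (hv : v ≠ 0) (u : ℝ) (f : ℝ → ℝ≥0∞)
    (hf : Measurable f) :
    ∫⁻ w, f (u + w) * ENNReal.ofReal (Real.exp (-(u * w) / v - u ^ 2 / (2 * v)))
      ∂(gaussianReal 0 v) = ∫⁻ w, f w ∂(gaussianReal 0 v) := by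
  have hvp : (0 : ℝ) < v := by positivity
  rw [gaussianReal_of_var_ne_zero _ hv, lintegral_withDensity_eq_lintegral_mul _
    (measurable_gaussianPDF _ _) (by fun_prop), lintegral_withDensity_eq_lintegral_mul _
    (measurable_gaussianPDF _ _) hf]
  conv_rhs => rw [← lintegral_add_left_eq_self _ u]
  refine lintegral_congr fun w => ?_
  simp only [Pi.mul_apply]
  rw [mul_comm (f (u + w)), ← mul_assoc]
  congr 1
  rw [gaussianPDF, gaussianPDF, ← ENNReal.ofReal_mul (gaussianPDFReal_nonneg _ _ _),
    gaussianPDFReal, gaussianPDFReal, mul_assoc, ← Real.exp_add]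
  congr 3
  field_simp
  ring

theorem lintegral_pi_gaussianReal_shift {n : ℕ} {v : ℝ≥0} (hv : v ≠ 0) (u : Fin n → ℝ)
    (f : (Fin n → ℝ) → ℝ≥0∞) (hf : Measurable f) :
    ∫⁻ w, f (u + w) * ENNReal.ofReal (Real.exp (-(u ⬝ᵥ w) / v - u ⬝ᵥ u / (2 * v)))
      ∂(Measure.pi fun _ : Fin n => gaussianReal 0 v)
      = ∫⁻ w, f w ∂(Measure.pi fun _ : Fin n => gaussianReal 0 v) := by
  set γ := Measure.pi fun _ : Fin n => gaussianReal 0 v with hγ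
  set E : (Fin n → ℝ) → ℝ≥0∞ := fun w =>
    ENNReal.ofReal (Real.exp (-(u ⬝ᵥ w) / v - u ⬝ᵥ u / (2 * v))) with hE
  have hEm : Measurable E := by
    simp only [hE]; unfold dotProduct; fun_prop
  have hEprod : ∀ w, E w = ∏ i, ENNReal.ofReal
      (Real.exp (-(u i * w i) / v - u i ^ 2 / (2 * v))) := by
    intro w
    rw [← ENNReal.ofReal_prod_of_nonneg fun i _ => (Real.exp_pos _).le, ← Real.exp_sum]
    simp only [hE, dotProduct, Finset.sum_sub_distrib, ← Finset.sum_div, Finset.sum_neg_distrib, sq]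
  have hadd : Measurable fun w : Fin n → ℝ => u + w := by fun_prop
  have key : γ = (γ.withDensity E).map (fun w => u + w) := by
    refine Measure.pi_eq fun s hs => ?_
    have hS : MeasurableSet (Set.univ.pi s) := MeasurableSet.univ_pi hs
    rw [Measure.map_apply hadd hS, withDensity_apply _ (hadd hS),
      ← lintegral_indicator (hadd hS)]
    have h1 : ∀ w, ((fun w => u + w) ⁻¹' Set.univ.pi s).indicator E w
        = ∏ i, (s i).indicator 1 (u i + w i) *
          ENNReal.ofReal (Real.exp (-(u i * w i) / v - u i ^ 2 / (2 * v))) := by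
      intro w
      rw [Finset.prod_mul_distrib, ← hEprod]
      by_cases h : ∀ i, u i + w i ∈ s i
      · rw [Set.indicator_of_mem (by simpa [Set.mem_pi] using h),
          Finset.prod_eq_one fun i _ => by simp [h i], one_mul]
      · rw [Set.indicator_of_notMem (by simpa [Set.mem_pi] using h)]
        push Not at h
        obtain ⟨i, hi⟩ := h
        rw [Finset.prod_eq_zero (Finset.mem_univ i) (by simp [hi]), zero_mul]
    simp_rw [h1]
    have hm1 : ∀ i, Measurable ((s i).indicator (1 : ℝ → ℝ≥0∞)) := fun i =>
      measurable_one.indicator (hs i)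
    rw [hγ, lintegral_pi_prod _ (f := fun i y => (s i).indicator 1 (u i + y) *
          ENNReal.ofReal (Real.exp (-(u i * y) / v - u i ^ 2 / (2 * v))))
      (fun i => by have := hm1 i; fun_prop)]
    refine Finset.prod_congr rfl fun i _ => ?_
    rw [lintegral_gaussianReal_shift hv (u i) _ (hm1 i), lintegral_indicator_one (hs i)]
  conv_rhs => rw [key]
  rw [lintegral_map hf hadd]
  refine Eq.trans ?_ (lintegral_withDensity_eq_lintegral_mul _ hEm (hf.comp hadd)).symm
  exact lintegral_congr fun w => mul_comm _ _

theorem lintegral_sq_gaussianReal (v : ℝ≥0) :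
    ∫⁻ z, ENNReal.ofReal (z ^ 2) ∂(gaussianReal 0 v) = v := by
  have h : MemLp (fun z : ℝ => z) 2 (gaussianReal 0 v) := memLp_id_gaussianReal 2
  rw [← ofReal_integral_eq_lintegral_ofReal h.integrable_sq
    (Filter.Eventually.of_forall fun z => sq_nonneg z)]
  have := variance_of_integral_eq_zero (X := id) (μ := gaussianReal 0 v)
    (by fun_prop) (by simp)
  rw [variance_id_gaussianReal] at this
  simp only [id] at this ⊢
  rw [← this]
  simp

theorem measurable_sq_mulVec {d n : ℕ} (A : Matrix (Fin d) (Fin n) ℝ) :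
    Measurable fun w => (A *ᵥ w) ⬝ᵥ (A *ᵥ w) := by
  unfold Matrix.mulVec dotProduct
  fun_prop

theorem half_le_pi_gaussianReal {d n : ℕ} {v : ℝ≥0} (A : Matrix (Fin d) (Fin n) ℝ)
    (hA : (∑ r, A r ⬝ᵥ A r) * v ≤ 1 / 2) :
    1 / 2 ≤ (Measure.pi fun _ : Fin n => gaussianReal 0 v)
      {w | (A *ᵥ w) ⬝ᵥ (A *ᵥ w) ≤ 1} := by
  set γ := Measure.pi fun _ : Fin n => gaussianReal 0 v with hγ
  have hm := measurable_sq_mulVec A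
  have hS : MeasurableSet {w | (A *ᵥ w) ⬝ᵥ (A *ᵥ w) ≤ 1} := measurableSet_le hm measurable_const
  have hnn : ∀ r, 0 ≤ A r ⬝ᵥ A r := fun r => Finset.sum_nonneg fun i _ => mul_self_nonneg _
  have h1 : ∫⁻ w, ENNReal.ofReal ((A *ᵥ w) ⬝ᵥ (A *ᵥ w)) ∂γ ≤ 1 / 2 := by
    have e : ∀ w, ENNReal.ofReal ((A *ᵥ w) ⬝ᵥ (A *ᵥ w))
        = ∑ r, ENNReal.ofReal ((w ⬝ᵥ A r) ^ 2) := by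
      intro w
      rw [← ENNReal.ofReal_sum_of_nonneg fun r _ => sq_nonneg _]
      congr 1
      refine Finset.sum_congr rfl fun r _ => ?_
      rw [dotProduct_comm w, sq]
      rfl
    have hmr : ∀ r, Measurable fun w : Fin n → ℝ => w ⬝ᵥ A r := by
      intro r; unfold dotProduct; fun_prop
    simp_rw [e]
    rw [lintegral_finsetSum _ fun r _ => by have := hmr r; fun_prop]
    have e2 : ∀ r, ∫⁻ w, ENNReal.ofReal ((w ⬝ᵥ A r) ^ 2) ∂γ = ENNReal.ofReal (A r ⬝ᵥ A r * v) := by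
      intro r
      rw [← lintegral_map (μ := γ) (f := fun z => ENNReal.ofReal (z ^ 2)) (by fun_prop) (hmr r),
        hγ, map_dotProduct_pi_gaussianReal, lintegral_sq_gaussianReal, ENNReal.ofReal_mul (hnn r),
        mul_comm, ENNReal.coe_mul]
      simp [ENNReal.ofReal]
    simp_rw [e2]
    rw [← ENNReal.ofReal_sum_of_nonneg fun r _ => mul_nonneg (hnn r) v.coe_nonneg,
      ← Finset.sum_mul]
    refine (ENNReal.ofReal_le_ofReal hA).trans_eq ?_
    rw [ENNReal.ofReal_div_of_pos (by norm_num)]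
    simp
  have h2 : γ {w | (A *ᵥ w) ⬝ᵥ (A *ᵥ w) ≤ 1}ᶜ ≤ 1 / 2 := by
    refine le_trans ?_ h1
    refine le_trans (measure_mono ?_)
      ((one_mul (γ _)).symm.trans_le (mul_meas_ge_le_lintegral (μ := γ)
        (f := fun w => ENNReal.ofReal ((A *ᵥ w) ⬝ᵥ (A *ᵥ w))) (by fun_prop) 1))
    intro w hw
    simp only [Set.mem_compl_iff, Set.mem_ofPred_eq, not_le] at hw ⊢
    rw [← ENNReal.ofReal_one]
    exact ENNReal.ofReal_le_ofReal hw.le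
  have h3 : (1 : ℝ≥0∞) = γ {w | (A *ᵥ w) ⬝ᵥ (A *ᵥ w) ≤ 1} + γ {w | (A *ᵥ w) ⬝ᵥ (A *ᵥ w) ≤ 1}ᶜ := by
    rw [measure_add_measure_compl hS, measure_univ]
  by_contra hc
  push Not at hc
  have : (1 : ℝ≥0∞) < 1 / 2 + 1 / 2 := by
    conv_lhs => rw [h3]
    exact ENNReal.add_lt_add_of_lt_of_le (by finiteness) hc h2
  rw [ENNReal.add_halves] at this
  exact lt_irrefl _ this

theorem measurePreserving_neg_pi_gaussianReal (n : ℕ) (v : ℝ≥0) :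
    MeasurePreserving (fun w : Fin n → ℝ => -w) (Measure.pi fun _ : Fin n => gaussianReal 0 v)
      (Measure.pi fun _ : Fin n => gaussianReal 0 v) :=
  measurePreserving_pi (fun _ : Fin n => gaussianReal 0 v) (fun _ : Fin n => gaussianReal 0 v)
    (f := fun _ x => -x) fun _ => ⟨measurable_neg, by rw [gaussianReal_map_neg, neg_zero]⟩

theorem measure_le_setLIntegral_exp {n : ℕ} {v : ℝ≥0} {S : Set (Fin n → ℝ)} (hS : MeasurableSet S)
    (hneg : (fun w => -w) ⁻¹' S = S) (h : Fin n → ℝ) :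
    (Measure.pi fun _ : Fin n => gaussianReal 0 v) S ≤
      ∫⁻ w in S, ENNReal.ofReal (Real.exp (h ⬝ᵥ w))
        ∂(Measure.pi fun _ : Fin n => gaussianReal 0 v) := by
  set γ := Measure.pi fun _ : Fin n => gaussianReal 0 v with hγ
  have hm : Measurable fun w : Fin n → ℝ => h ⬝ᵥ w := by unfold dotProduct; fun_prop
  have h1 : ∫⁻ w in S, ENNReal.ofReal (Real.exp (-(h ⬝ᵥ w))) ∂γ
      = ∫⁻ w in S, ENNReal.ofReal (Real.exp (h ⬝ᵥ w)) ∂γ := by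
    rw [← (measurePreserving_neg_pi_gaussianReal n v).setLIntegral_comp_preimage hS (by fun_prop),
      hneg]
    simp [hγ]
  have h2 : ∫⁻ w in S, 2 ∂γ ≤ ∫⁻ w in S, (ENNReal.ofReal (Real.exp (h ⬝ᵥ w)) +
      ENNReal.ofReal (Real.exp (-(h ⬝ᵥ w)))) ∂γ := by
    refine lintegral_mono fun w => ?_
    dsimp only
    rw [← ENNReal.ofReal_add (Real.exp_pos _).le (Real.exp_pos _).le,
      show (2 : ℝ≥0∞) = ENNReal.ofReal 2 by simp]
    refine ENNReal.ofReal_le_ofReal ?_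
    linarith [Real.one_le_cosh (h ⬝ᵥ w), Real.cosh_eq (h ⬝ᵥ w)]
  rw [lintegral_add_left (by fun_prop), h1, ← two_mul, setLIntegral_const] at h2
  exact (ENNReal.mul_le_mul_iff_right (by simp) (by simp)).1 h2

theorem exp_le_setLIntegral_exp {d n : ℕ} {v : ℝ≥0} (hv : v ≠ 0) (A : Matrix (Fin d) (Fin n) ℝ)
    (hA : (∑ r, A r ⬝ᵥ A r) * v ≤ 1 / 2) {u : Fin n → ℝ} (hu : u ⬝ᵥ u ≤ 1)
    (hAu : (A *ᵥ u) ⬝ᵥ (A *ᵥ u) ≤ 1) (c : Fin n → ℝ) :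
    ENNReal.ofReal (Real.exp (c ⬝ᵥ u)) ≤ ENNReal.ofReal (2 * Real.exp (1 / (2 * v))) *
      ∫⁻ w in {w | (A *ᵥ w) ⬝ᵥ (A *ᵥ w) ≤ 4}, ENNReal.ofReal (Real.exp (c ⬝ᵥ w))
        ∂(Measure.pi fun _ : Fin n => gaussianReal 0 v) := by
  set γ := Measure.pi fun _ : Fin n => gaussianReal 0 v with hγ
  have hvp : (0 : ℝ) < v := by positivity
  set S := {w | (A *ᵥ w) ⬝ᵥ (A *ᵥ w) ≤ 1} with hSd
  set T := {w | (A *ᵥ w) ⬝ᵥ (A *ᵥ w) ≤ 4} with hTd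
  have hm := measurable_sq_mulVec A
  have hS : MeasurableSet S := measurableSet_le hm measurable_const
  have hT : MeasurableSet T := measurableSet_le hm measurable_const
  have hmc : ∀ h : Fin n → ℝ, Measurable fun w : Fin n → ℝ => h ⬝ᵥ w := by
    intro h; unfold dotProduct; fun_prop
  have hST : ∀ w ∈ S, u + w ∈ T := by
    intro w hw
    simp only [hSd, hTd, Set.mem_ofPred_eq] at hw ⊢
    have hq : 0 ≤ (A *ᵥ u - A *ᵥ w) ⬝ᵥ (A *ᵥ u - A *ᵥ w) :=
      Finset.sum_nonneg fun i _ => mul_self_nonneg _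
    simp only [mulVec_add, add_dotProduct, dotProduct_add, sub_dotProduct, dotProduct_sub] at hq ⊢
    linarith
  have hhalf := (half_le_pi_gaussianReal A hA).trans
    (measure_le_setLIntegral_exp (v := v) hS (by ext w; simp [hSd, mulVec_neg]) (c - (v : ℝ)⁻¹ • u))
  rw [← hγ] at hhalf
  have hf : Measurable (T.indicator fun w => ENNReal.ofReal (Real.exp (c ⬝ᵥ w))) := by
    have := hmc c
    exact Measurable.indicator (by fun_prop) hT
  rw [← lintegral_indicator hT, hγ, ← lintegral_pi_gaussianReal_shift hv u _ hf, ← hγ]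
  have h1 : ENNReal.ofReal (Real.exp (c ⬝ᵥ u - 1 / (2 * v))) *
      ∫⁻ w in S, ENNReal.ofReal (Real.exp ((c - (v : ℝ)⁻¹ • u) ⬝ᵥ w)) ∂γ ≤
      ∫⁻ w, T.indicator (fun w => ENNReal.ofReal (Real.exp (c ⬝ᵥ w))) (u + w) *
        ENNReal.ofReal (Real.exp (-(u ⬝ᵥ w) / v - u ⬝ᵥ u / (2 * v))) ∂γ := by
    rw [← lintegral_indicator hS, ← lintegral_const_mul' _ _ ENNReal.ofReal_ne_top]
    refine lintegral_mono fun w => ?_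
    by_cases hw : w ∈ S
    · simp only [Set.indicator_of_mem hw, Set.indicator_of_mem (hST w hw)]
      rw [← ENNReal.ofReal_mul (Real.exp_pos _).le, ← ENNReal.ofReal_mul (Real.exp_pos _).le,
        ← Real.exp_add, ← Real.exp_add]
      refine ENNReal.ofReal_le_ofReal (Real.exp_le_exp.2 ?_)
      have : u ⬝ᵥ u / (2 * v) ≤ 1 / (2 * v) := by gcongr
      simp only [sub_dotProduct, smul_dotProduct, dotProduct_add, smul_eq_mul]
      have e : -(u ⬝ᵥ w) / (v : ℝ) = -((v : ℝ)⁻¹ * (u ⬝ᵥ w)) := by field_simp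
      rw [e]
      linarith
    · simp [Set.indicator_of_notMem hw]
  refine le_trans ?_ (mul_le_mul_right (le_trans (mul_le_mul_right hhalf _) h1) _)
  rw [show (1 / 2 : ℝ≥0∞) = ENNReal.ofReal (1 / 2) by
      rw [ENNReal.ofReal_div_of_pos (by norm_num)]; simp,
    ← ENNReal.ofReal_mul (Real.exp_pos _).le, ← ENNReal.ofReal_mul (by positivity)]
  refine ENNReal.ofReal_le_ofReal (le_of_eq ?_)
  rw [Real.exp_sub]
  field_simp

instance isProbabilityMeasure_gaussianMatrix (k d : ℕ) :
    IsProbabilityMeasure (gaussianMatrix k d) := by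
  unfold gaussianMatrix
  infer_instance

theorem exists_dotProduct_eq_bilin {k d n : ℕ} (P : Fin k → Fin d → ℝ)
    (A : Matrix (Fin d) (Fin n) ℝ) (l : ℝ) (b : Fin d → ℝ) :
    ∃ c : Fin n → ℝ, ∀ u, c ⬝ᵥ u =
      l * ((Matrix.of P *ᵥ (A *ᵥ u)) ⬝ᵥ (Matrix.of P *ᵥ b) - (A *ᵥ u) ⬝ᵥ b) := by
  refine ⟨l • ((Matrix.of P *ᵥ b) ᵥ* (Matrix.of P * A) - b ᵥ* A), fun u => ?_⟩
  rw [smul_dotProduct, sub_dotProduct, ← dotProduct_mulVec, ← dotProduct_mulVec, mulVec_mulVec,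
    dotProduct_comm b, dotProduct_comm (Matrix.of P *ᵥ b), smul_eq_mul]

theorem lintegral_setLIntegral_setLIntegral_le {X Y Z : Type*} [MeasurableSpace X]
    [MeasurableSpace Y] [MeasurableSpace Z] {μ : Measure X} {ν : Measure Y} {ρ : Measure Z}
    [SFinite μ] [IsProbabilityMeasure ν] [IsProbabilityMeasure ρ] {g : X → Y → Z → ℝ≥0∞}
    (hg : Measurable fun p : X × Y × Z => g p.1 p.2.1 p.2.2) {S : Set Y} {T : Set Z}
    (hS : MeasurableSet S) (hT : MeasurableSet T) {C : ℝ≥0∞}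
    (h : ∀ y ∈ S, ∀ z ∈ T, ∫⁻ x, g x y z ∂μ ≤ C) :
    Measurable (fun x => ∫⁻ y in S, ∫⁻ z in T, g x y z ∂ρ ∂ν) ∧
      ∫⁻ x, ∫⁻ y in S, ∫⁻ z in T, g x y z ∂ρ ∂ν ∂μ ≤ C := by
  have hg' : Measurable fun q : (X × Y) × Z => g q.1.1 q.1.2 q.2 :=
    hg.comp (by fun_prop : Measurable fun q : (X × Y) × Z => (q.1.1, q.1.2, q.2))
  have hin : Measurable fun q : X × Y => ∫⁻ z in T, g q.1 q.2 z ∂ρ :=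
    Measurable.lintegral_prod_right (f := fun (q : X × Y) z => g q.1 q.2 z) hg'
  refine ⟨Measurable.lintegral_prod_right (f := fun x y => ∫⁻ z in T, g x y z ∂ρ) hin, ?_⟩
  rw [lintegral_lintegral_swap (f := fun x y => ∫⁻ z in T, g x y z ∂ρ) hin.aemeasurable]
  refine (setLIntegral_mono' (g := fun _ => C) hS fun y hy => ?_).trans ?_
  · have hy' : Measurable fun q : X × Z => g q.1 y q.2 :=
      hg.comp (by fun_prop : Measurable fun q : X × Z => (q.1, y, q.2))
    rw [lintegral_lintegral_swap (f := fun x z => g x y z) hy'.aemeasurable]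
    refine (setLIntegral_mono' (g := fun _ => C) hT fun z hz => h y hy z hz).trans ?_
    rw [setLIntegral_const]
    exact mul_le_of_le_one_right' prob_le_one
  · rw [setLIntegral_const]
    exact mul_le_of_le_one_right' prob_le_one

theorem gaussianMatrix_bilin_tail {k d n : ℕ} (hk : 0 < k) (A B : Matrix (Fin d) (Fin n) ℝ)
    {v : ℝ≥0} (hv : v ≠ 0) (hA : (∑ r, A r ⬝ᵥ A r) * v ≤ 1 / 2)
    (hB : (∑ r, B r ⬝ᵥ B r) * v ≤ 1 / 2)
    (hA1 : ∀ u, u ⬝ᵥ u ≤ 1 → (A *ᵥ u) ⬝ᵥ (A *ᵥ u) ≤ 1)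
    (hB1 : ∀ u, u ⬝ᵥ u ≤ 1 → (B *ᵥ u) ⬝ᵥ (B *ᵥ u) ≤ 1)
    {l : ℝ} (hl : 0 ≤ l) (hlk : l ≤ k / 32) (L : ℝ) :
    gaussianMatrix k d {P | ∃ u w, u ⬝ᵥ u ≤ 1 ∧ w ⬝ᵥ w ≤ 1 ∧
      L ≤ l * ((Matrix.of P *ᵥ (A *ᵥ u)) ⬝ᵥ (Matrix.of P *ᵥ (B *ᵥ w)) - (A *ᵥ u) ⬝ᵥ (B *ᵥ w))}
      ≤ ENNReal.ofReal (4 * Real.exp (1 / v + 128 * l ^ 2 / k - L)) := by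
  set γ := Measure.pi fun _ : Fin n => gaussianReal 0 v with hγ
  set F : (Fin k → Fin d → ℝ) → (Fin n → ℝ) → (Fin n → ℝ) → ℝ := fun P u w =>
    l * ((Matrix.of P *ᵥ (A *ᵥ u)) ⬝ᵥ (Matrix.of P *ᵥ (B *ᵥ w)) - (A *ᵥ u) ⬝ᵥ (B *ᵥ w)) with hF
  set SA := {w | (A *ᵥ w) ⬝ᵥ (A *ᵥ w) ≤ 4} with hSA
  set SB := {w | (B *ᵥ w) ⬝ᵥ (B *ᵥ w) ≤ 4} with hSB
  have mSA : MeasurableSet SA := measurableSet_le (measurable_sq_mulVec A) measurable_const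
  have mSB : MeasurableSet SB := measurableSet_le (measurable_sq_mulVec B) measurable_const
  have hFm : Measurable fun p : (Fin k → Fin d → ℝ) × (Fin n → ℝ) × (Fin n → ℝ) =>
      ENNReal.ofReal (Real.exp (F p.1 p.2.1 p.2.2)) := by
    simp only [hF]
    unfold Matrix.mulVec dotProduct
    simp only [of_apply]
    fun_prop
  set Z : (Fin k → Fin d → ℝ) → ℝ≥0∞ := fun P =>
    ∫⁻ θ in SA, ∫⁻ ν in SB, ENNReal.ofReal (Real.exp (F P θ ν)) ∂γ ∂γ with hZ
  obtain ⟨hZm, hZint⟩ := lintegral_setLIntegral_setLIntegral_le (μ := gaussianMatrix k d) (ν := γ)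
    (ρ := γ) (g := fun P θ ν => ENNReal.ofReal (Real.exp (F P θ ν))) hFm mSA mSB
    (C := ENNReal.ofReal (Real.exp (128 * l ^ 2 / k)))
    fun θ hθ ν hν => lintegral_exp_bilin_gaussianMatrix_le hk _ _ hθ hν hl hlk
  change Measurable Z at hZm
  change ∫⁻ P, Z P ∂(gaussianMatrix k d) ≤ _ at hZint
  set K := ENNReal.ofReal (2 * Real.exp (1 / (2 * v))) with hK
  have hpt : ∀ P u w, u ⬝ᵥ u ≤ 1 → w ⬝ᵥ w ≤ 1 →
      ENNReal.ofReal (Real.exp (F P u w)) ≤ K * K * Z P := by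
    intro P u w hu hw
    obtain ⟨c, hc⟩ := exists_dotProduct_eq_bilin P A l (B *ᵥ w)
    have h1 := exp_le_setLIntegral_exp hv A hA hu (hA1 u hu) c
    simp only [hc] at h1
    refine h1.trans ?_
    rw [mul_assoc]
    refine mul_le_mul_right ?_ _
    simp only [hZ]
    rw [← lintegral_const_mul' _ _ ENNReal.ofReal_ne_top]
    refine lintegral_mono fun θ => ?_
    obtain ⟨c, hc⟩ := exists_dotProduct_eq_bilin P B l (A *ᵥ θ)
    have h2 := exp_le_setLIntegral_exp hv B hB hw (hB1 w hw) c
    simp only [hc, dotProduct_comm _ (Matrix.of P *ᵥ (A *ᵥ θ)), dotProduct_comm _ (A *ᵥ θ)] at h2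
    exact h2
  have hKK : K * K = ENNReal.ofReal (4 * Real.exp (1 / v)) := by
    rw [hK, ← ENNReal.ofReal_mul (by positivity)]
    congr 1
    rw [show (1 / v : ℝ) = 1 / (2 * v) + 1 / (2 * v) by ring, Real.exp_add]
    ring
  have hmk := mul_meas_ge_le_lintegral (μ := gaussianMatrix k d) (hZm.const_mul (K * K))
    (ENNReal.ofReal (Real.exp L))
  rw [lintegral_const_mul _ hZm] at hmk
  have hfin := hmk.trans (mul_le_mul_right hZint _)
  rw [hKK, ← ENNReal.ofReal_mul (by positivity), mul_assoc, ← Real.exp_add] at hfin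
  have hsub : gaussianMatrix k d {P | ∃ u w, u ⬝ᵥ u ≤ 1 ∧ w ⬝ᵥ w ≤ 1 ∧ L ≤ F P u w} ≤
      gaussianMatrix k d {P | ENNReal.ofReal (Real.exp L) ≤
        ENNReal.ofReal (4 * Real.exp (1 / v)) * Z P} := by
    refine measure_mono ?_
    rintro P ⟨u, w, hu, hw, hL⟩
    have := hpt P u w hu hw
    rw [hKK] at this
    exact (ENNReal.ofReal_le_ofReal (Real.exp_le_exp.2 hL)).trans this
  refine hsub.trans ?_
  rw [← ENNReal.mul_le_mul_iff_right (a := ENNReal.ofReal (Real.exp L))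
    (by simp [Real.exp_pos]) ENNReal.ofReal_ne_top]
  refine hfin.trans_eq ?_
  rw [← ENNReal.ofReal_mul (Real.exp_pos _).le]
  congr 1
  rw [Real.exp_sub]
  field_simp

theorem gaussianMatrix_norm_tail {k d : ℕ} (hk : 0 < k) (x : Fin d → ℝ) (hx : 0 < x ⬝ᵥ x)
    {τ : ℝ} (hτ : 0 ≤ τ) (hτ1 : τ ≤ 1) :
    gaussianMatrix k d {P | τ * (x ⬝ᵥ x) ≤
        |(Matrix.of P *ᵥ x) ⬝ᵥ (Matrix.of P *ᵥ x) - x ⬝ᵥ x|}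
      ≤ ENNReal.ofReal (2 * Real.exp (-(τ ^ 2 * k / 8))) := by
  have hk' : (0 : ℝ) < k := by exact_mod_cast hk
  set G : (Fin k → Fin d → ℝ) → ℝ := fun P =>
    (Matrix.of P *ᵥ x) ⬝ᵥ (Matrix.of P *ᵥ x) - x ⬝ᵥ x with hG
  have hGm : Measurable G := by
    have := measurable_mulVec (m := k) x
    simp only [hG]
    unfold dotProduct
    fun_prop
  have key : ∀ s : ℝ, |s| = τ * k / (4 * (x ⬝ᵥ x)) →
      gaussianMatrix k d {P | τ ^ 2 * k / 4 ≤ s * G P}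
        ≤ ENNReal.ofReal (Real.exp (-(τ ^ 2 * k / 8))) := by
    intro s hs
    have hmk := (mul_meas_ge_le_lintegral (μ := gaussianMatrix k d)
      (f := fun P => ENNReal.ofReal (Real.exp (s * G P))) (by fun_prop)
      (ENNReal.ofReal (Real.exp (τ ^ 2 * k / 4)))).trans
      (lintegral_exp_gaussianMatrix_le hk x (s := s) (by
        rw [hs]; field_simp; exact hτ1))
    have hsub : gaussianMatrix k d {P | τ ^ 2 * k / 4 ≤ s * G P} ≤
        gaussianMatrix k d {P | ENNReal.ofReal (Real.exp (τ ^ 2 * k / 4)) ≤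
          ENNReal.ofReal (Real.exp (s * G P))} :=
      measure_mono fun P hP => ENNReal.ofReal_le_ofReal (Real.exp_le_exp.2 hP)
    refine hsub.trans ?_
    rw [← ENNReal.mul_le_mul_iff_right (a := ENNReal.ofReal (Real.exp (τ ^ 2 * k / 4)))
      (by simp [Real.exp_pos]) ENNReal.ofReal_ne_top]
    refine hmk.trans_eq ?_
    rw [← ENNReal.ofReal_mul (Real.exp_pos _).le, ← Real.exp_add, ← sq_abs s, hs]
    congr 2
    field_simp
    ring
  set s := τ * k / (4 * (x ⬝ᵥ x)) with hs
  have hs0 : 0 ≤ s := by positivity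
  have hsub : {P | τ * (x ⬝ᵥ x) ≤ |G P|} ⊆
      {P | τ ^ 2 * k / 4 ≤ s * G P} ∪ {P | τ ^ 2 * k / 4 ≤ -s * G P} := by
    intro P hP
    have e : τ ^ 2 * k / 4 = s * (τ * (x ⬝ᵥ x)) := by rw [hs]; field_simp
    simp only [Set.mem_union, Set.mem_ofPred_eq, e] at hP ⊢
    rcases le_abs.1 hP with h | h
    · exact Or.inl (mul_le_mul_of_nonneg_left h hs0)
    · right
      rw [neg_mul_comm]
      exact mul_le_mul_of_nonneg_left h hs0
  refine (measure_mono hsub).trans ((measure_union_le _ _).trans ?_)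
  refine (add_le_add (key s (abs_of_nonneg hs0))
    (key (-s) (by rw [abs_neg, abs_of_nonneg hs0]))).trans_eq ?_
  rw [← ENNReal.ofReal_add (Real.exp_pos _).le (Real.exp_pos _).le]
  congr 1
  ring

theorem norm_toLp_eq {m : ℕ} (x : Fin m → ℝ) : ‖WithLp.toLp 2 x‖ = √(x ⬝ᵥ x) := by
  rw [EuclideanSpace.norm_eq]
  congr 1
  exact Finset.sum_congr rfl fun i _ => by simp [sq]

theorem sqrt_mulVec_le_specNorm {m n : ℕ} (A : Matrix (Fin m) (Fin n) ℝ) (w : Fin n → ℝ) :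
    √((A *ᵥ w) ⬝ᵥ (A *ᵥ w)) ≤ specNorm A * √(w ⬝ᵥ w) := by
  have := (LinearMap.toContinuousLinearMap (Matrix.toEuclideanLin A)).le_opNorm (WithLp.toLp 2 w)
  rw [norm_toLp_eq w] at this
  rw [← norm_toLp_eq (A *ᵥ w)]
  exact this

theorem specNorm_le {m n : ℕ} (A : Matrix (Fin m) (Fin n) ℝ) {c : ℝ} (hc : 0 ≤ c)
    (h : ∀ w, √((A *ᵥ w) ⬝ᵥ (A *ᵥ w)) ≤ c * √(w ⬝ᵥ w)) : specNorm A ≤ c := by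
  refine ContinuousLinearMap.opNorm_le_bound _ hc fun w => ?_
  have := h w.ofLp
  rw [← norm_toLp_eq, ← norm_toLp_eq] at this
  exact this

theorem specNorm_nonneg {m n : ℕ} (A : Matrix (Fin m) (Fin n) ℝ) : 0 ≤ specNorm A :=
  norm_nonneg _

theorem dotProduct_le_sqrt_mul_sqrt {m : ℕ} (a b : Fin m → ℝ) :
    a ⬝ᵥ b ≤ √(a ⬝ᵥ a) * √(b ⬝ᵥ b) := by
  have := Real.sum_mul_le_sqrt_mul_sqrt Finset.univ a b
  simpa only [dotProduct, sq] using this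

theorem specNorm_le_of_bilin {m n : ℕ} (A : Matrix (Fin m) (Fin n) ℝ) {c : ℝ} (hc : 0 ≤ c)
    (h : ∀ u w, u ⬝ᵥ (A *ᵥ w) ≤ c * (√(u ⬝ᵥ u) * √(w ⬝ᵥ w))) : specNorm A ≤ c := by
  refine specNorm_le A hc fun w => ?_
  have h1 := h (A *ᵥ w) w
  have h0 : 0 ≤ (A *ᵥ w) ⬝ᵥ (A *ᵥ w) := Finset.sum_nonneg fun i _ => mul_self_nonneg _
  rcases (Real.sqrt_nonneg ((A *ᵥ w) ⬝ᵥ (A *ᵥ w))).eq_or_lt with h2 | h2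
  · rw [← h2]; positivity
  · refine le_of_mul_le_mul_left ?_ h2
    rw [Real.mul_self_sqrt h0]
    linarith

theorem specNorm_pos {m n : ℕ} {A : Matrix (Fin m) (Fin n) ℝ} (hA : A ≠ 0) : 0 < specNorm A := by
  refine norm_pos_iff.2 ?_
  simpa using hA

theorem sq_frobNorm {m n : ℕ} (A : Matrix (Fin m) (Fin n) ℝ) :
    frobNorm A ^ 2 = ∑ r, A r ⬝ᵥ A r := by
  rw [frobNorm, Real.sq_sqrt (by positivity)]
  simp only [dotProduct, sq]

theorem specNorm_le_frobNorm {m n : ℕ} (A : Matrix (Fin m) (Fin n) ℝ) :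
    specNorm A ≤ frobNorm A := by
  have hf : 0 ≤ frobNorm A := Real.sqrt_nonneg _
  refine specNorm_le A hf fun w => ?_
  have hw : 0 ≤ w ⬝ᵥ w := Finset.sum_nonneg fun i _ => mul_self_nonneg _
  rw [Real.sqrt_le_left (by positivity), mul_pow, Real.sq_sqrt hw, sq_frobNorm, Finset.sum_mul]
  refine Finset.sum_le_sum fun r _ => ?_
  have := Finset.sum_mul_sq_le_sq_mul_sq Finset.univ (A r) w
  simpa only [dotProduct, sq, mulVec] using this

theorem dotProduct_rescaledJL_mulVec {k d n : ℕ} (P : Fin k → Fin d → ℝ)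
    (A B : Matrix (Fin d) (Fin n) ℝ) (u w : Fin n → ℝ) :
    u ⬝ᵥ (rescaledJL P A B *ᵥ w) =
      (Matrix.of P *ᵥ (A *ᵥ fun i => cnorm A i / cnorm (Matrix.of P * A) i * u i)) ⬝ᵥ
      (Matrix.of P *ᵥ (B *ᵥ fun i => cnorm B i / cnorm (Matrix.of P * B) i * w i)) := by
  have h : rescaledJL P A B = Matrix.diagonal (fun i => cnorm A i / cnorm (Matrix.of P * A) i) *
      ((Matrix.of P * A)ᵀ * (Matrix.of P * B)) *
      Matrix.diagonal (fun i => cnorm B i / cnorm (Matrix.of P * B) i) := by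
    ext i j
    rw [mul_diagonal, diagonal_mul, rescaledJL, of_apply]
    ring
  have hu : u ᵥ* Matrix.diagonal (fun i => cnorm A i / cnorm (Matrix.of P * A) i) =
      fun i => cnorm A i / cnorm (Matrix.of P * A) i * u i := by
    ext i; rw [vecMul_diagonal, mul_comm]
  have hw : Matrix.diagonal (fun i => cnorm B i / cnorm (Matrix.of P * B) i) *ᵥ w =
      fun i => cnorm B i / cnorm (Matrix.of P * B) i * w i := by
    ext i; rw [mulVec_diagonal]
  rw [h, ← mulVec_mulVec, ← mulVec_mulVec, ← mulVec_mulVec, hw, dotProduct_mulVec, hu,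
    dotProduct_mulVec, vecMul_transpose, ← mulVec_mulVec, ← mulVec_mulVec]

theorem sqrt_dotProduct_mul_le {n : ℕ} (x u : Fin n → ℝ) {c : ℝ} (hc : 0 ≤ c)
    (hx : ∀ i, |x i| ≤ c) :
    √((fun i => x i * u i) ⬝ᵥ (fun i => x i * u i)) ≤ c * √(u ⬝ᵥ u) := by
  have hu : 0 ≤ u ⬝ᵥ u := Finset.sum_nonneg fun i _ => mul_self_nonneg _
  rw [Real.sqrt_le_left (by positivity), mul_pow, Real.sq_sqrt hu, dotProduct, dotProduct,
    Finset.mul_sum]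
  refine Finset.sum_le_sum fun i _ => ?_
  have h1 : x i ^ 2 ≤ c ^ 2 := sq_le_sq' (abs_le.1 (hx i)).1 (abs_le.1 (hx i)).2
  nlinarith [mul_le_mul_of_nonneg_right h1 (sq_nonneg (u i))]

theorem specNorm_rescaledJL_sub_le {k d n : ℕ} (P : Fin k → Fin d → ℝ)
    (A B : Matrix (Fin d) (Fin n) ℝ) {e : ℝ} (he : 0 < e) (he1 : e ≤ 1 / 56)
    (hA : ∀ i, |cnorm A i / cnorm (Matrix.of P * A) i - 1| ≤ e)
    (hB : ∀ i, |cnorm B i / cnorm (Matrix.of P * B) i - 1| ≤ e)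
    (hN : ∀ u w, (Matrix.of P *ᵥ (A *ᵥ u)) ⬝ᵥ (Matrix.of P *ᵥ (B *ᵥ w)) - (A *ᵥ u) ⬝ᵥ (B *ᵥ w) ≤
      e * (specNorm A * √(u ⬝ᵥ u) * (specNorm B * √(w ⬝ᵥ w)))) :
    specNorm (rescaledJL P A B - Aᵀ * B) ≤ 4 * e * specNorm A * specNorm B := by
  have a0 := specNorm_nonneg A
  have b0 := specNorm_nonneg B
  refine specNorm_le_of_bilin _ (by positivity) fun u w => ?_
  set x := fun i => cnorm A i / cnorm (Matrix.of P * A) i with hx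
  set y := fun i => cnorm B i / cnorm (Matrix.of P * B) i with hy
  have abs_le_of : ∀ t : ℝ, |t - 1| ≤ e → |t| ≤ 1 + e := by
    intro t ht
    have := abs_add_le (t - 1) 1
    rw [sub_add_cancel, abs_one] at this
    linarith
  have hxu := sqrt_dotProduct_mul_le x u (by positivity) fun i => abs_le_of _ (hA i)
  have hyw := sqrt_dotProduct_mul_le y w (by positivity) fun i => abs_le_of _ (hB i)
  have hxu' := sqrt_dotProduct_mul_le (fun i => x i - 1) u he.le hA
  have hyw' := sqrt_dotProduct_mul_le (fun i => y i - 1) w he.le hB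
  have hsplit : u ⬝ᵥ ((rescaledJL P A B - Aᵀ * B) *ᵥ w) =
      ((Matrix.of P *ᵥ (A *ᵥ fun i => x i * u i)) ⬝ᵥ (Matrix.of P *ᵥ (B *ᵥ fun i => y i * w i))
        - (A *ᵥ fun i => x i * u i) ⬝ᵥ (B *ᵥ fun i => y i * w i))
      + (A *ᵥ fun i => (x i - 1) * u i) ⬝ᵥ (B *ᵥ fun i => y i * w i)
      + (A *ᵥ u) ⬝ᵥ (B *ᵥ fun i => (y i - 1) * w i) := by
    have e1 : (fun i => (x i - 1) * u i) = (fun i => x i * u i) - u := by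
      ext i; simp [sub_mul]
    have e2 : (fun i => (y i - 1) * w i) = (fun i => y i * w i) - w := by
      ext i; simp [sub_mul]
    rw [sub_mulVec, dotProduct_sub, dotProduct_rescaledJL_mulVec, ← mulVec_mulVec,
      dotProduct_mulVec u Aᵀ, vecMul_transpose, e1, e2, mulVec_sub, mulVec_sub, sub_dotProduct,
      dotProduct_sub]
    ring
  rw [hsplit]
  set s := √(u ⬝ᵥ u) with hs
  set t := √(w ⬝ᵥ w) with ht
  have s0 : 0 ≤ s := Real.sqrt_nonneg _
  have t0 : 0 ≤ t := Real.sqrt_nonneg _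
  have T1 := (hN (fun i => x i * u i) (fun i => y i * w i)).trans
    (show _ ≤ e * (specNorm A * ((1 + e) * s) * (specNorm B * ((1 + e) * t))) by gcongr)
  have T2 := (dotProduct_le_sqrt_mul_sqrt (A *ᵥ fun i => (x i - 1) * u i)
    (B *ᵥ fun i => y i * w i)).trans
    (show _ ≤ (specNorm A * (e * s)) * (specNorm B * ((1 + e) * t)) from
      mul_le_mul ((sqrt_mulVec_le_specNorm _ _).trans (by gcongr))
        ((sqrt_mulVec_le_specNorm _ _).trans (by gcongr)) (Real.sqrt_nonneg _) (by positivity))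
  have T3 := (dotProduct_le_sqrt_mul_sqrt (A *ᵥ u) (B *ᵥ fun i => (y i - 1) * w i)).trans
    (show _ ≤ (specNorm A * s) * (specNorm B * (e * t)) from
      mul_le_mul (sqrt_mulVec_le_specNorm _ _)
        ((sqrt_mulVec_le_specNorm _ _).trans (by gcongr)) (Real.sqrt_nonneg _) (by positivity))
  have hQ : 0 ≤ specNorm A * specNorm B * (s * t) := by positivity
  have hcoef : e * (1 + e) ^ 2 + e * (1 + e) + e ≤ 4 * e := by nlinarith [sq_nonneg e]
  nlinarith [mul_le_mul_of_nonneg_right hcoef hQ]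

theorem cnorm_mul_eq {k d n : ℕ} (P : Fin k → Fin d → ℝ) (A : Matrix (Fin d) (Fin n) ℝ)
    (i : Fin n) : cnorm (Matrix.of P * A) i =
      √((Matrix.of P *ᵥ fun r => A r i) ⬝ᵥ (Matrix.of P *ᵥ fun r => A r i)) := by
  rw [cnorm]
  congr 1
  exact Finset.sum_congr rfl fun r _ => sq _

theorem abs_cnorm_div_sub_one_le {k d n : ℕ} (P : Fin k → Fin d → ℝ)
    (A : Matrix (Fin d) (Fin n) ℝ) (i : Fin n) {τ : ℝ} (hτ1 : τ ≤ 1 / 2)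
    (hi : 0 < (fun r => A r i) ⬝ᵥ (fun r => A r i))
    (h : |(Matrix.of P *ᵥ fun r => A r i) ⬝ᵥ (Matrix.of P *ᵥ fun r => A r i)
      - (fun r => A r i) ⬝ᵥ (fun r => A r i)| ≤ τ * ((fun r => A r i) ⬝ᵥ (fun r => A r i))) :
    |cnorm A i / cnorm (Matrix.of P * A) i - 1| ≤ 2 * τ := by
  rw [cnorm_mul_eq]
  have hc : cnorm A i = √((fun r => A r i) ⬝ᵥ (fun r => A r i)) := by
    rw [cnorm]
    congr 1
    exact Finset.sum_congr rfl fun r _ => sq _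
  rw [hc]
  set q := (Matrix.of P *ᵥ fun r => A r i) ⬝ᵥ (Matrix.of P *ᵥ fun r => A r i)
  set p := (fun r => A r i) ⬝ᵥ (fun r => A r i)
  obtain ⟨h1, h2⟩ := abs_le.1 h
  have hq : 0 < q := by nlinarith
  have hb := Real.sqrt_pos.2 hq
  have ha := Real.sqrt_pos.2 hi
  have hbb := Real.mul_self_sqrt hq.le
  have haa := Real.mul_self_sqrt hi.le
  set a := √p
  set b := √q
  have hba : |a - b| ≤ τ * a := by
    have h3 : |a - b| * (a + b) ≤ τ * a * (a + b) := by
      rw [← abs_of_pos (add_pos ha hb), ← abs_mul, abs_of_pos (add_pos ha hb),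
        show (a - b) * (a + b) = -(q - p) by rw [← hbb, ← haa]; ring, abs_neg]
      have hτ0 : 0 ≤ τ := by
        by_contra hneg
        have := abs_nonneg (q - p)
        nlinarith
      refine h.trans ?_
      rw [← haa]
      nlinarith [mul_nonneg hτ0 (mul_pos ha hb).le]
    exact le_of_mul_le_mul_right h3 (add_pos ha hb)
  have hb2 : a ≤ 2 * b := by
    have := (abs_le.1 hba).2
    nlinarith
  have hτ0 : 0 ≤ τ := by
    have := (abs_nonneg _).trans hba
    exact nonneg_of_mul_nonneg_left this ha
  rw [div_sub_one hb.ne', abs_div, abs_of_pos hb, div_le_iff₀ hb]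
  nlinarith

theorem bilin_le_of_unit {m n : ℕ} (f : (Fin m → ℝ) → (Fin n → ℝ) → ℝ)
    (hfl : ∀ (c : ℝ) u w, f (c • u) w = c * f u w) (hfr : ∀ (c : ℝ) u w, f u (c • w) = c * f u w)
    {e : ℝ} (h : ∀ u w, u ⬝ᵥ u ≤ 1 → w ⬝ᵥ w ≤ 1 → f u w ≤ e) (u : Fin m → ℝ) (w : Fin n → ℝ) :
    f u w ≤ e * (√(u ⬝ᵥ u) * √(w ⬝ᵥ w)) := by
  have unit : ∀ {p : ℕ} (z : Fin p → ℝ), ∃ z' : Fin p → ℝ, z' ⬝ᵥ z' ≤ 1 ∧ z = √(z ⬝ᵥ z) • z' := by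
    intro p z
    have hz : 0 ≤ z ⬝ᵥ z := Finset.sum_nonneg fun i _ => mul_self_nonneg _
    rcases hz.eq_or_lt with h0 | h0
    · refine ⟨0, by simp, ?_⟩
      rw [smul_zero]
      exact dotProduct_self_eq_zero.1 h0.symm
    · have hs := Real.sqrt_pos.2 h0
      refine ⟨(√(z ⬝ᵥ z))⁻¹ • z, ?_, ?_⟩
      · rw [smul_dotProduct, dotProduct_smul, smul_eq_mul, smul_eq_mul]
        conv_lhs => rw [← mul_assoc, ← mul_inv, Real.mul_self_sqrt hz]
        rw [inv_mul_cancel₀ h0.ne']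
      · rw [smul_smul, mul_inv_cancel₀ hs.ne', one_smul]
  obtain ⟨u', hu', eu⟩ := unit u
  obtain ⟨w', hw', ew⟩ := unit w
  have s0 := Real.sqrt_nonneg (u ⬝ᵥ u)
  have t0 := Real.sqrt_nonneg (w ⬝ᵥ w)
  generalize √(u ⬝ᵥ u) = s at *
  generalize √(w ⬝ᵥ w) = t at *
  rw [eu, ew, hfl, hfr]
  nlinarith [mul_le_mul_of_nonneg_left (h u' w' hu' hw') (mul_nonneg s0 t0)]

theorem sum_dotProduct_inv_specNorm_smul {d n : ℕ} (A : Matrix (Fin d) (Fin n) ℝ) :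
    ∑ r, ((specNorm A)⁻¹ • A) r ⬝ᵥ ((specNorm A)⁻¹ • A) r = frobNorm A ^ 2 / specNorm A ^ 2 := by
  rw [sq_frobNorm, Finset.sum_div]
  refine Finset.sum_congr rfl fun r _ => ?_
  rw [show ((specNorm A)⁻¹ • A) r = (specNorm A)⁻¹ • A r from rfl, smul_dotProduct,
    dotProduct_smul, smul_eq_mul, smul_eq_mul]
  ring

theorem inv_specNorm_smul_mulVec_le_one {d n : ℕ} {A : Matrix (Fin d) (Fin n) ℝ} (hA : A ≠ 0)
    (u : Fin n → ℝ) (hu : u ⬝ᵥ u ≤ 1) :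
    (((specNorm A)⁻¹ • A) *ᵥ u) ⬝ᵥ (((specNorm A)⁻¹ • A) *ᵥ u) ≤ 1 := by
  have h0 := specNorm_pos hA
  have h1 : √((A *ᵥ u) ⬝ᵥ (A *ᵥ u)) ≤ specNorm A :=
    (sqrt_mulVec_le_specNorm A u).trans
      (mul_le_of_le_one_right h0.le (Real.sqrt_le_one.2 hu))
  have h2 := (Real.sqrt_le_left h0.le).1 h1
  rw [smul_mulVec, smul_dotProduct, dotProduct_smul, smul_eq_mul, smul_eq_mul, ← mul_assoc,
    ← sq, inv_pow, inv_mul_le_iff₀ (by positivity), mul_one]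
  exact h2

theorem gaussianMatrix_bilin_specNorm_tail {k d n : ℕ} (hk : 0 < k)
    {A B : Matrix (Fin d) (Fin n) ℝ} (hA : A ≠ 0) (hB : B ≠ 0) {r e : ℝ} (hr : 0 < r)
    (hrA : frobNorm A ^ 2 / specNorm A ^ 2 ≤ r) (hrB : frobNorm B ^ 2 / specNorm B ^ 2 ≤ r)
    (he : 0 < e) (he1 : e ≤ 8) :
    gaussianMatrix k d {P | ¬ ∀ u w,
      (Matrix.of P *ᵥ (A *ᵥ u)) ⬝ᵥ (Matrix.of P *ᵥ (B *ᵥ w)) - (A *ᵥ u) ⬝ᵥ (B *ᵥ w) ≤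
        e * (specNorm A * √(u ⬝ᵥ u) * (specNorm B * √(w ⬝ᵥ w)))} ≤
      ENNReal.ofReal (4 * Real.exp (2 * r - e ^ 2 * k / 512)) := by
  have a0 := specNorm_pos hA
  have b0 := specNorm_pos hB
  have k0 : (0 : ℝ) < k := Nat.cast_pos.2 hk
  set v : ℝ≥0 := Real.toNNReal (1 / (2 * r)) with hv
  have hv' : (v : ℝ) = 1 / (2 * r) := Real.coe_toNNReal _ (by positivity)
  have hv0 : v ≠ 0 := (Real.toNNReal_pos.2 (by positivity)).ne'
  have half : ∀ s, s ≤ r → s * (v : ℝ) ≤ 1 / 2 := by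
    intro s hs
    rw [hv', mul_one_div, div_le_iff₀ (by positivity)]
    linarith
  have key := gaussianMatrix_bilin_tail hk ((specNorm A)⁻¹ • A) ((specNorm B)⁻¹ • B) hv0
    (by rw [sum_dotProduct_inv_specNorm_smul]; exact half _ hrA)
    (by rw [sum_dotProduct_inv_specNorm_smul]; exact half _ hrB)
    (inv_specNorm_smul_mulVec_le_one hA) (inv_specNorm_smul_mulVec_le_one hB)
    (l := e * k / 256) (by positivity) (by nlinarith) (e * k / 256 * e)
  refine (measure_mono fun P hP => ?_).trans (key.trans_eq ?_)
  · by_contra hcon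
    simp only [Set.mem_ofPred_eq, not_exists, not_and, not_le] at hP hcon
    refine hP ?_
    intro u w
    have := bilin_le_of_unit (fun u w => (Matrix.of P *ᵥ (((specNorm A)⁻¹ • A) *ᵥ u)) ⬝ᵥ
      (Matrix.of P *ᵥ (((specNorm B)⁻¹ • B) *ᵥ w)) -
      (((specNorm A)⁻¹ • A) *ᵥ u) ⬝ᵥ (((specNorm B)⁻¹ • B) *ᵥ w))
      (fun c u w => by
        simp only [mulVec_smul, smul_dotProduct, smul_eq_mul]; ring)
      (fun c u w => by
        simp only [mulVec_smul, dotProduct_smul, smul_eq_mul]; ring)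
      (fun u w hu hw => (lt_of_mul_lt_mul_left (hcon u w hu hw) (by positivity)).le) u w
    simp only [smul_mulVec, mulVec_smul, smul_dotProduct, dotProduct_smul, smul_eq_mul] at this
    have h2 := mul_le_mul_of_nonneg_left this (mul_pos a0 b0).le
    field_simp at h2
    linarith
  · rw [hv']
    congr 3
    field_simp
    ring

theorem gaussianMatrix_column_tail {k d n : ℕ} (hk : 0 < k) (A : Matrix (Fin d) (Fin n) ℝ)
    (hA : ∀ i, (fun r => A r i) ≠ (0 : Fin d → ℝ)) {τ : ℝ} (hτ : 0 ≤ τ) (hτ1 : τ ≤ 1 / 2) :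
    gaussianMatrix k d {P | ¬ ∀ i, |cnorm A i / cnorm (Matrix.of P * A) i - 1| ≤ 2 * τ} ≤
      ENNReal.ofReal (n * (2 * Real.exp (-(τ ^ 2 * k / 8)))) := by
  have hpos : ∀ i, 0 < (fun r => A r i) ⬝ᵥ (fun r => A r i) := fun i =>
    (Finset.sum_nonneg fun r _ => mul_self_nonneg (A r i)).lt_of_ne fun h =>
      hA i (dotProduct_self_eq_zero.1 h.symm)
  have hsub : {P | ¬ ∀ i, |cnorm A i / cnorm (Matrix.of P * A) i - 1| ≤ 2 * τ} ⊆
      ⋃ i, {P : Fin k → Fin d → ℝ | τ * ((fun r => A r i) ⬝ᵥ (fun r => A r i)) ≤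
        |(Matrix.of P *ᵥ fun r => A r i) ⬝ᵥ (Matrix.of P *ᵥ fun r => A r i)
          - (fun r => A r i) ⬝ᵥ (fun r => A r i)|} := by
    intro P hP
    by_contra hcon
    simp only [Set.mem_iUnion, Set.mem_ofPred_eq, not_exists, not_le] at hP hcon
    exact hP fun i => abs_cnorm_div_sub_one_le P A i hτ1 (hpos i) (hcon i).le
  refine (measure_mono hsub).trans ((measure_iUnion_fintype_le _ _).trans ?_)
  refine (Finset.sum_le_sum fun i _ =>
    gaussianMatrix_norm_tail hk _ (hpos i) hτ (hτ1.trans (by norm_num))).trans_eq ?_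
  rw [Finset.sum_const, Finset.card_univ, Fintype.card_fin, nsmul_eq_mul,
    ENNReal.ofReal_mul (Nat.cast_nonneg n), ENNReal.ofReal_natCast]

theorem one_le_sq_frobNorm_div_sq_specNorm {d n : ℕ} {A : Matrix (Fin d) (Fin n) ℝ}
    (hA : A ≠ 0) : 1 ≤ frobNorm A ^ 2 / specNorm A ^ 2 := by
  have h0 := specNorm_pos hA
  rw [one_le_div (by positivity)]
  exact pow_le_pow_left₀ h0.le (specNorm_le_frobNorm A) 2

theorem ofReal_one_sub_le_measure {Ω : Type*} [MeasurableSpace Ω] (μ : Measure Ω)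
    [IsProbabilityMeasure μ] {s : Set Ω} {δ : ℝ} (hδ : 0 ≤ δ) (h : μ sᶜ ≤ ENNReal.ofReal δ) :
    ENNReal.ofReal (1 - δ) ≤ μ s := by
  rw [ENNReal.ofReal_sub _ hδ, ENNReal.ofReal_one, tsub_le_iff_right]
  calc 1 = μ (s ∪ sᶜ) := by rw [Set.union_compl_self, measure_univ]
    _ ≤ μ s + μ sᶜ := measure_union_le _ _
    _ ≤ μ s + ENNReal.ofReal δ := by gcongr

theorem stmt4 :
    ∃ C : ℝ, 0 < C ∧
      ∀ (ε δ : ℝ), 0 < ε → ε < 1 / 14 → 0 < δ → δ < 1 →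
      ∀ (d n k : ℕ) (A B : Matrix (Fin d) (Fin n) ℝ),
        A ≠ 0 → B ≠ 0 →
        (∀ i, (fun r => A r i) ≠ (0 : Fin d → ℝ)) →
        (∀ j, (fun r => B r j) ≠ (0 : Fin d → ℝ)) →
        C * (max (frobNorm A ^ 2 / specNorm A ^ 2) (frobNorm B ^ 2 / specNorm B ^ 2)
              + Real.log (n / δ)) / ε ^ 2 ≤ k →
        ENNReal.ofReal (1 - δ) ≤
          gaussianMatrix k d
            {P | specNorm (rescaledJL P A B - Aᵀ * B) ≤ ε * specNorm A * specNorm B} := by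
  refine ⟨40960, by norm_num, ?_⟩
  intro ε δ hε hε1 hδ hδ1 d n k A B hA hB hAc hBc hk
  set r := max (frobNorm A ^ 2 / specNorm A ^ 2) (frobNorm B ^ 2 / specNorm B ^ 2) with hr
  have hr1 : 1 ≤ r := (one_le_sq_frobNorm_div_sq_specNorm hA).trans (le_max_left _ _)
  have hn : 1 ≤ n := by
    rcases n.eq_zero_or_pos with rfl | h
    · exact absurd (Subsingleton.elim A 0) hA
    · exact h
  have hn1 : (1 : ℝ) ≤ n := by exact_mod_cast hn
  have hnδ : 1 ≤ n / δ := by rw [one_le_div hδ]; linarith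
  have hlog : 0 ≤ Real.log (n / δ) := Real.log_nonneg hnδ
  rw [div_le_iff₀ (by positivity)] at hk
  have k0 : (0 : ℝ) < k := by
    have : 0 < (k : ℝ) * ε ^ 2 := by linarith
    exact pos_of_mul_pos_left this (sq_nonneg ε)
  have hk0 : 0 < k := by exact_mod_cast k0
  have exp_log : Real.exp (-Real.log (n / δ)) = δ / n := by
    rw [Real.exp_neg, Real.exp_log (by positivity), inv_div]
  have exp_three : Real.exp (-3) ≤ 1 / 8 := by
    rw [Real.exp_neg, ← one_div]
    refine one_div_le_one_div_of_le (by norm_num) ?_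
    have h2 : (2 : ℝ) ≤ Real.exp 1 := by linarith [Real.add_one_le_exp (1 : ℝ)]
    calc (8 : ℝ) = 2 ^ 3 := by norm_num
      _ ≤ Real.exp 1 ^ 3 := pow_le_pow_left₀ (by norm_num) h2 3
      _ = Real.exp 3 := by rw [← Real.exp_nat_mul]; norm_num
  have small : ∀ t, t ≤ -3 - Real.log (n / δ) → Real.exp t ≤ δ / n / 8 := by
    intro t ht
    calc Real.exp t ≤ Real.exp (-3 + -Real.log (n / δ)) := Real.exp_le_exp.2 (by linarith)
      _ = Real.exp (-3) * (δ / n) := by rw [Real.exp_add, exp_log]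
      _ ≤ 1 / 8 * (δ / n) := by gcongr
      _ = δ / n / 8 := by ring
  have h1 := gaussianMatrix_bilin_specNorm_tail (r := r) (e := ε / 4) hk0 hA hB (by linarith)
    (le_max_left _ _) (le_max_right _ _) (by positivity) (by linarith)
  have h2 := gaussianMatrix_column_tail (τ := ε / 8) hk0 A hAc (by positivity) (by linarith)
  have h3 := gaussianMatrix_column_tail (τ := ε / 8) hk0 B hBc (by positivity) (by linarith)
  have b1 : 4 * Real.exp (2 * r - (ε / 4) ^ 2 * k / 512) ≤ δ / 2 := by
    have h4 := small (2 * r - (ε / 4) ^ 2 * k / 512) (by nlinarith)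
    have h5 : δ / n ≤ δ := div_le_self hδ.le hn1
    linarith
  have b2 : n * (2 * Real.exp (-((ε / 8) ^ 2 * k / 8))) ≤ δ / 4 := by
    have h4 := small (-((ε / 8) ^ 2 * k / 8)) (by nlinarith)
    calc n * (2 * Real.exp (-((ε / 8) ^ 2 * k / 8))) ≤ n * (2 * (δ / n / 8)) := by gcongr
      _ = δ / 4 := by field_simp; norm_num
  refine ofReal_one_sub_le_measure _ hδ.le ?_
  calc _ ≤ gaussianMatrix k d (_ ∪ (_ ∪ _)) := measure_mono fun P hP => ?_
    _ ≤ _ := (measure_union_le _ _).trans (add_le_add h1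
      ((measure_union_le _ _).trans (add_le_add h2 h3)))
    _ ≤ ENNReal.ofReal (δ / 2) + (ENNReal.ofReal (δ / 4) + ENNReal.ofReal (δ / 4)) := by gcongr
    _ = ENNReal.ofReal δ := by
      rw [← ENNReal.ofReal_add (by positivity) (by positivity),
        ← ENNReal.ofReal_add (by positivity) (by positivity)]
      congr 1
      ring
  by_contra hcon
  simp only [Set.mem_union, Set.mem_ofPred_eq, not_or, not_not] at hcon
  obtain ⟨hN, hPA, hPB⟩ := hcon
  rw [show 2 * (ε / 8) = ε / 4 by ring] at hPA hPB
  have := specNorm_rescaledJL_sub_le P A B (by positivity) (by linarith) hPA hPB hN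
  rw [show 4 * (ε / 4) = ε by ring] at this
  exact hP this
end

section
/- Let A, B be nonzero real d×n matrices, let m > 0, let ε ≥ 0, and let (i,j) ∈ [n]×[n] be such that A_i ≠ 0 or B_j ≠ 0. If x ∈ R satisfies |x| ≤ (1+ε)·‖A_i‖·‖B_j‖, then |x|/q_ij ≤ (1+ε)·(n/m)·(‖A‖_F² + ‖B‖_F²), where q_ij = m·(‖A_i‖²/(2n‖A‖_F²) + ‖B_j‖²/(2n‖B‖_F²)). -/
open MeasureTheory ProbabilityTheory Matrix
open scoped NNReal ENNReal

/-- The sampling probabilities q_ij = m·(‖A_i‖²/(2n‖A‖_F²) + ‖B_j‖²/(2n‖B‖_F²)). -/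
noncomputable def sampleProb {d n : ℕ} (A B : Matrix (Fin d) (Fin n) ℝ) (m : ℝ)
    (i j : Fin n) : ℝ :=
  m * (cnorm A i ^ 2 / (2 * n * frobNorm A ^ 2) + cnorm B j ^ 2 / (2 * n * frobNorm B ^ 2))

theorem frobNorm_sq_pos {d n : ℕ} {A : Matrix (Fin d) (Fin n) ℝ} (hA : A ≠ 0) :
    0 < frobNorm A ^ 2 := by
  obtain ⟨r, i, hri⟩ : ∃ r i, A r i ≠ 0 := by
    by_contra! h
    exact hA (Matrix.ext h)
  have hpos : 0 < ∑ r, ∑ i, (A r i) ^ 2 :=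
    Finset.sum_pos' (fun r _ => Finset.sum_nonneg fun i _ => sq_nonneg _)
      ⟨r, Finset.mem_univ r, Finset.sum_pos' (fun i _ => sq_nonneg _)
        ⟨i, Finset.mem_univ i, by positivity⟩⟩
  exact pow_pos (Real.sqrt_pos.2 hpos) 2

theorem two_mul_mul_le_div_add_div_mul_add (a b : ℝ) {s t : ℝ} (hs : 0 < s) (ht : 0 < t) :
    2 * a * b ≤ (a ^ 2 / s + b ^ 2 / t) * (s + t) := by
  have hexpand : (a ^ 2 / s + b ^ 2 / t) * (s + t) =
      a ^ 2 + b ^ 2 + (a ^ 2 / s * t + b ^ 2 / t * s) := by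
    field_simp
    ring
  have hcross : 0 ≤ a ^ 2 / s * t + b ^ 2 / t * s := by positivity
  rw [hexpand]
  linarith [two_mul_le_add_sq a b]

theorem stmt5 {d n : ℕ} (A B : Matrix (Fin d) (Fin n) ℝ) (hA : A ≠ 0) (hB : B ≠ 0)
    (m ε : ℝ) (hm : 0 < m) (hε : 0 ≤ ε) (i j : Fin n)
    (hij : (fun r => A r i) ≠ (0 : Fin d → ℝ) ∨ (fun r => B r j) ≠ (0 : Fin d → ℝ))
    (x : ℝ) (hx : |x| ≤ (1 + ε) * cnorm A i * cnorm B j) :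
    |x| / sampleProb A B m i j ≤ (1 + ε) * (n / m) * (frobNorm A ^ 2 + frobNorm B ^ 2) := by
  have hF := frobNorm_sq_pos hA
  have hG := frobNorm_sq_pos hB
  have hn : (0 : ℝ) < n := Nat.cast_pos.2 i.pos
  have hq : 0 ≤ sampleProb A B m i j := by
    unfold sampleProb
    positivity
  refine div_le_of_le_mul₀ hq (by positivity) (hx.trans ?_)
  have hbound := mul_le_mul_of_nonneg_left
    (two_mul_mul_le_div_add_div_mul_add (cnorm A i) (cnorm B j) hF hG)
    (by positivity : 0 ≤ (1 + ε) / 2)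
  calc (1 + ε) * cnorm A i * cnorm B j
      = (1 + ε) / 2 * (2 * cnorm A i * cnorm B j) := by ring
    _ ≤ _ := hbound
    _ = _ := by
      unfold sampleProb
      field_simp
end

section
/- Let A, B be nonzero real d×n matrices, let m > 0, let 0 ≤ ε ≤ 1, and fix a row index i with A_i ≠ 0. Let S ⊆ [n] and let x_j ∈ R satisfy |x_j| ≤ (1+ε)·‖A_i‖·‖B_j‖ for every j ∈ S. Then ∑_{j∈S} x_j²/q_ij ≤ (1+ε)·(2n/m)·(‖A‖_F² + ‖B‖_F²)², where q_ij = m·(‖A_i‖²/(2n‖A‖_F²) + ‖B_j‖²/(2n‖B‖_F²)). -/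
open MeasureTheory ProbabilityTheory Matrix
open scoped NNReal ENNReal

theorem cnorm_sq {d n : ℕ} (A : Matrix (Fin d) (Fin n) ℝ) (i : Fin n) :
    cnorm A i ^ 2 = ∑ r, A r i ^ 2 :=
  Real.sq_sqrt (Finset.sum_nonneg fun _ _ => sq_nonneg _)

theorem frobNorm_sq {d n : ℕ} (A : Matrix (Fin d) (Fin n) ℝ) :
    frobNorm A ^ 2 = ∑ j, cnorm A j ^ 2 := by
  simp only [cnorm_sq]
  rw [Finset.sum_comm]
  exact Real.sq_sqrt (Finset.sum_nonneg fun _ _ => Finset.sum_nonneg fun _ _ => sq_nonneg _)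

theorem cnorm_sq_pos {d n : ℕ} {A : Matrix (Fin d) (Fin n) ℝ} {i : Fin n}
    (hAi : (fun r => A r i) ≠ (0 : Fin d → ℝ)) : 0 < cnorm A i ^ 2 := by
  rw [cnorm_sq]
  obtain ⟨r, hr⟩ := Function.ne_iff.mp hAi
  exact Finset.sum_pos' (fun _ _ => sq_nonneg _) ⟨r, Finset.mem_univ r, sq_pos_of_ne_zero hr⟩

theorem sum_cnorm_sq_le {d n : ℕ} (A : Matrix (Fin d) (Fin n) ℝ) (S : Finset (Fin n)) :
    ∑ j ∈ S, cnorm A j ^ 2 ≤ frobNorm A ^ 2 := by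
  rw [frobNorm_sq]
  exact Finset.sum_le_univ_sum_of_nonneg fun _ => sq_nonneg _

/-- Keeping only the row term of the sampling probability bounds each summand. -/
theorem sq_div_sampleProb_le {d n : ℕ} {A B : Matrix (Fin d) (Fin n) ℝ} {m c y : ℝ}
    (hm : 0 < m) {i j : Fin n} (hAi : 0 < cnorm A i ^ 2)
    (hy : |y| ≤ c * cnorm A i * cnorm B j) :
    y ^ 2 / sampleProb A B m i j ≤
      c ^ 2 * (2 * n / m) * frobNorm A ^ 2 * cnorm B j ^ 2 := by
  have hn : (0 : ℝ) < n := by exact_mod_cast i.pos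
  have hF : 0 < frobNorm A ^ 2 :=
    hAi.trans_le (by simpa using sum_cnorm_sq_le A {i})
  have hq : m * (cnorm A i ^ 2 / (2 * n * frobNorm A ^ 2)) ≤ sampleProb A B m i j := by
    unfold sampleProb
    gcongr
    exact le_add_of_nonneg_right (by positivity)
  have hq_pos : 0 < m * (cnorm A i ^ 2 / (2 * n * frobNorm A ^ 2)) := by positivity
  rw [div_le_iff₀ (hq_pos.trans_le hq)]
  calc y ^ 2 = |y| ^ 2 := (sq_abs y).symm
    _ ≤ (c * cnorm A i * cnorm B j) ^ 2 := by gcongr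
    _ = c ^ 2 * (2 * n / m) * frobNorm A ^ 2 * cnorm B j ^ 2 *
          (m * (cnorm A i ^ 2 / (2 * n * frobNorm A ^ 2))) := by
        have hF' : frobNorm A ≠ 0 := by
          rintro h
          simp [h] at hF
        field_simp
    _ ≤ _ := by gcongr

theorem stmt6 {d n : ℕ} (A B : Matrix (Fin d) (Fin n) ℝ) (hA : A ≠ 0) (hB : B ≠ 0)
    (m ε : ℝ) (hm : 0 < m) (hε : 0 ≤ ε) (hε' : ε ≤ 1) (i : Fin n)
    (hAi : (fun r => A r i) ≠ (0 : Fin d → ℝ))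
    (S : Finset (Fin n)) (x : Fin n → ℝ)
    (hx : ∀ j ∈ S, |x j| ≤ (1 + ε) * cnorm A i * cnorm B j) :
    ∑ j ∈ S, x j ^ 2 / sampleProb A B m i j ≤
      (1 + ε) * (2 * n / m) * (frobNorm A ^ 2 + frobNorm B ^ 2) ^ 2 := by
  have hF : 0 ≤ frobNorm A ^ 2 := sq_nonneg _
  have hG : 0 ≤ frobNorm B ^ 2 := sq_nonneg _
  calc ∑ j ∈ S, x j ^ 2 / sampleProb A B m i j
      ≤ ∑ j ∈ S, (1 + ε) ^ 2 * (2 * n / m) * frobNorm A ^ 2 * cnorm B j ^ 2 :=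
        Finset.sum_le_sum fun j hj => sq_div_sampleProb_le hm (cnorm_sq_pos hAi) (hx j hj)
    _ = (1 + ε) ^ 2 * (2 * n / m) * frobNorm A ^ 2 * ∑ j ∈ S, cnorm B j ^ 2 := by
        rw [Finset.mul_sum]
    _ ≤ (1 + ε) ^ 2 * (2 * n / m) * frobNorm A ^ 2 * frobNorm B ^ 2 := by
        gcongr
        exact sum_cnorm_sq_le B S
    _ = (1 + ε) * (2 * n / m) * ((1 + ε) * (frobNorm A ^ 2 * frobNorm B ^ 2)) := by ring
    _ ≤ (1 + ε) * (2 * n / m) * (frobNorm A ^ 2 + frobNorm B ^ 2) ^ 2 := by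
        gcongr
        nlinarith [mul_nonneg hF hG, mul_le_mul_of_nonneg_right hε' (mul_nonneg hF hG)]
end

section
/- Let 0 < ε < 1 and 0 < δ < 1, and let A, B be real d×n matrices. There exists an absolute constant C > 0 such that if k ≥ C·log(2n/δ)/ε², then with probability at least 1−δ over the random sketching matrix Π: (1−ε)·‖A‖_F² ≤ ‖ΠA‖_F² ≤ (1+ε)·‖A‖_F², (1−ε)·‖B‖_F² ≤ ‖ΠB‖_F² ≤ (1+ε)·‖B‖_F², and ‖(ΠA)^T(ΠB) − A^T B‖_F ≤ ε·‖A‖_F·‖B‖_F. -/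
open MeasureTheory ProbabilityTheory Matrix
open scoped NNReal ENNReal

open Real in
theorem exp_neg_add_sq_le_one_sub {s : ℝ} (hs : |s| ≤ 1 / 2) : exp (-(s + s ^ 2)) ≤ 1 - s := by
  obtain ⟨h1, h2⟩ := abs_le.mp hs
  have hpos : 0 < 1 - s := by linarith
  rw [exp_neg, inv_le_comm₀ (exp_pos _) hpos, inv_le_iff_one_le_mul₀' hpos]
  rcases le_total 0 s with h | h
  · have hq := quadratic_le_exp_of_nonneg (x := s + s ^ 2) (by positivity)
    have hp : 0 ≤ 1 - s - s ^ 2 - s ^ 3 := by nlinarith [mul_nonneg h h]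
    calc (1 : ℝ) ≤ (1 - s) * (1 + (s + s ^ 2) + (s + s ^ 2) ^ 2 / 2) := by
          nlinarith [mul_nonneg (sq_nonneg s) hp]
      _ ≤ _ := by gcongr
  · have hl := add_one_le_exp (s + s ^ 2)
    calc (1 : ℝ) ≤ (1 - s) * (s + s ^ 2 + 1) := by
          nlinarith [mul_nonneg (neg_nonneg.mpr h) (sq_nonneg s)]
      _ ≤ _ := by gcongr

theorem inv_sqrt_one_sub_le {s : ℝ} (hs : |s| ≤ 1 / 2) :
    (√(1 - s))⁻¹ ≤ Real.exp ((s + s ^ 2) / 2) := by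
  rw [inv_le_comm₀ (Real.sqrt_pos.mpr (by linarith [(abs_le.mp hs).2])) (Real.exp_pos _),
    ← Real.exp_neg]
  apply Real.le_sqrt_of_sq_le
  rw [← Real.exp_nat_mul]
  convert exp_neg_add_sq_le_one_sub hs using 2
  push_cast
  ring

theorem gaussianPDFReal_smul_exp_sq {v : ℝ≥0} (t y : ℝ) :
    gaussianPDFReal 0 v y • Real.exp (t * y ^ 2) =
      (√(2 * Real.pi * v))⁻¹ * Real.exp (-((2 * v : ℝ)⁻¹ - t) * y ^ 2) := by
  rw [gaussianPDFReal, smul_eq_mul, mul_assoc, ← Real.exp_add]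
  congr 2
  ring

theorem integrable_exp_mul_sq_gaussianReal {v : ℝ≥0} (hv : v ≠ 0) {t : ℝ} (ht : 2 * t * v < 1) :
    Integrable (fun y ↦ Real.exp (t * y ^ 2)) (gaussianReal 0 v) := by
  have hv' : (0 : ℝ) < v := NNReal.coe_pos.mpr (pos_iff_ne_zero.mpr hv)
  have hb : 0 < (2 * v : ℝ)⁻¹ - t := by
    rw [sub_pos, ← one_div, lt_div_iff₀ (by positivity)]
    linarith
  rw [gaussianReal_of_var_ne_zero _ hv, integrable_withDensity_iff_integrable_smul₀'
    (measurable_gaussianPDF 0 v).aemeasurable (ae_of_all _ fun _ ↦ gaussianPDF_lt_top)]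
  simp only [toReal_gaussianPDF, gaussianPDFReal_smul_exp_sq]
  exact (integrable_exp_neg_mul_sq hb).const_mul _

theorem integral_exp_mul_sq_gaussianReal {v : ℝ≥0} (hv : v ≠ 0) {t : ℝ} (ht : 2 * t * v < 1) :
    ∫ y, Real.exp (t * y ^ 2) ∂gaussianReal 0 v = (√(1 - 2 * t * v))⁻¹ := by
  have hv' : (0 : ℝ) < v := NNReal.coe_pos.mpr (pos_iff_ne_zero.mpr hv)
  have h1 : 0 < 1 - 2 * t * v := by linarith
  rw [integral_gaussianReal_eq_integral_smul hv]
  simp only [gaussianPDFReal_smul_exp_sq]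
  rw [integral_const_mul, integral_gaussian, ← Real.sqrt_inv, ← Real.sqrt_inv,
    ← Real.sqrt_mul (by positivity)]
  congr 1
  have : (2 * v : ℝ)⁻¹ - t = (1 - 2 * t * v) / (2 * v) := by field_simp
  rw [this]
  field_simp

theorem pi_gaussianReal_map_dotProduct {ι : Type*} [Fintype ι] (v : ℝ≥0) (x : ι → ℝ) :
    (Measure.pi fun _ : ι ↦ gaussianReal 0 v).map (fun p ↦ p ⬝ᵥ x) =
      gaussianReal 0 (Real.toNNReal (x ⬝ᵥ x) * v) := by
  have hm : Measurable fun p : ι → ℝ ↦ p ⬝ᵥ x := by unfold dotProduct; fun_prop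
  have := Measure.isProbabilityMeasure_map (μ := Measure.pi fun _ : ι ↦ gaussianReal 0 v)
    hm.aemeasurable
  apply Measure.ext_of_charFun
  ext t
  rw [charFun_apply_real, integral_map hm.aemeasurable (by fun_prop)]
  have h : ∀ p : ι → ℝ, Complex.exp (t * ((p ⬝ᵥ x : ℝ) : ℂ) * Complex.I) =
      ∏ i, Complex.exp (((t * x i : ℝ) : ℂ) * p i * Complex.I) := by
    intro p
    rw [← Complex.exp_sum, dotProduct]
    congr 1
    push_cast
    rw [Finset.mul_sum, Finset.sum_mul]
    exact Finset.sum_congr rfl fun i _ ↦ by ring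
  simp only [h]
  rw [integral_fintype_prod_eq_prod
    (f := fun i (y : ℝ) ↦ Complex.exp (((t * x i : ℝ) : ℂ) * y * Complex.I))]
  simp only [← charFun_apply_real, charFun_gaussianReal]
  rw [← Complex.exp_sum]
  congr 1
  have hx : 0 ≤ x ⬝ᵥ x := dotProduct_self_star_nonneg x
  rw [NNReal.coe_mul, Real.coe_toNNReal _ hx, dotProduct]
  push_cast
  simp only [Finset.sum_mul, Finset.sum_div, mul_zero, zero_mul, zero_sub,
    ← Finset.sum_neg_distrib]
  exact Finset.sum_congr rfl fun i _ ↦ by ring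

/-- The squared Euclidean norm of the sketch `P x`. -/
def sketchNormSq {k d : ℕ} (x : Fin d → ℝ) (P : Fin k → Fin d → ℝ) : ℝ :=
  (Matrix.of P *ᵥ x) ⬝ᵥ (Matrix.of P *ᵥ x)

theorem sketchNormSq_eq_sum {k d : ℕ} (x : Fin d → ℝ) (P : Fin k → Fin d → ℝ) :
    sketchNormSq x P = ∑ r, (P r ⬝ᵥ x) ^ 2 := by
  simp [sketchNormSq, dotProduct, mulVec, sq]

section Concentration

variable {k d : ℕ} {x : Fin d → ℝ} {s ε : ℝ}

theorem mgf_sketchNormSq (hk : 0 < k) (hx : 0 < x ⬝ᵥ x) (hs : s < 1) :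
    Integrable (fun P ↦ Real.exp (s * k / (2 * (x ⬝ᵥ x)) * sketchNormSq x P))
        (gaussianMatrix k d) ∧
      mgf (sketchNormSq x) (gaussianMatrix k d) (s * k / (2 * (x ⬝ᵥ x))) =
        (√(1 - s))⁻¹ ^ k := by
  set t := s * k / (2 * (x ⬝ᵥ x)) with ht
  set v : ℝ≥0 := Real.toNNReal (x ⬝ᵥ x) * (k : ℝ≥0)⁻¹ with hv
  have hk' : (0 : ℝ) < k := by exact_mod_cast hk
  have hv0 : v ≠ 0 := by
    simp [hv, hx, hk.ne']
  have hts : 2 * t * v = s := by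
    rw [hv, NNReal.coe_mul, Real.coe_toNNReal _ hx.le, ht]
    push_cast
    field_simp
  have hm : Measurable fun p : Fin d → ℝ ↦ p ⬝ᵥ x := by unfold dotProduct; fun_prop
  have hmap := pi_gaussianReal_map_dotProduct (k : ℝ≥0)⁻¹ x
  rw [← hv] at hmap
  have hprod : ∀ P : Fin k → Fin d → ℝ, Real.exp (t * sketchNormSq x P) =
      ∏ r, Real.exp (t * (P r ⬝ᵥ x) ^ 2) := by
    intro P
    rw [sketchNormSq_eq_sum, Finset.mul_sum, Real.exp_sum]
  have hexp_int := integrable_exp_mul_sq_gaussianReal hv0 (t := t) (by rwa [hts])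
  have hval := integral_exp_mul_sq_gaussianReal hv0 (t := t) (by rwa [hts])
  rw [← hmap, integrable_map_measure (by fun_prop) hm.aemeasurable] at hexp_int
  rw [← hmap, integral_map hm.aemeasurable (by fun_prop), hts] at hval
  simp only [mgf, hprod]
  refine ⟨?_, ?_⟩
  · exact Integrable.fintype_prod (f := fun _ (p : Fin d → ℝ) ↦ Real.exp (t * (p ⬝ᵥ x) ^ 2))
      fun _ ↦ hexp_int
  · rw [gaussianMatrix,
      integral_fintype_prod_eq_pow (f := fun p : Fin d → ℝ ↦ Real.exp (t * (p ⬝ᵥ x) ^ 2)), hval,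
      Fintype.card_fin]

theorem mgf_sketchNormSq_le (hk : 0 < k) (hx : 0 < x ⬝ᵥ x) (hs : |s| ≤ 1 / 2) :
    mgf (sketchNormSq x) (gaussianMatrix k d) (s * k / (2 * (x ⬝ᵥ x))) ≤
      Real.exp (k * ((s + s ^ 2) / 2)) := by
  rw [(mgf_sketchNormSq hk hx (by linarith [(abs_le.mp hs).2])).2, Real.exp_nat_mul]
  gcongr
  exact inv_sqrt_one_sub_le hs

theorem measureReal_sketchNormSq_ge_le (hk : 0 < k) (hx : 0 < x ⬝ᵥ x) (hε : 0 < ε) (hε1 : ε < 1) :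
    (gaussianMatrix k d).real {P | (1 + ε) * (x ⬝ᵥ x) ≤ sketchNormSq x P} ≤
      Real.exp (-(k * ε ^ 2 / 8)) := by
  have hs : |ε / 2| ≤ 1 / 2 := by rw [abs_of_pos] <;> linarith
  refine (measure_ge_le_exp_mul_mgf (t := ε / 2 * k / (2 * (x ⬝ᵥ x))) _ (by positivity)
    (mgf_sketchNormSq hk hx (by linarith)).1).trans ?_
  refine (mul_le_mul_of_nonneg_left (mgf_sketchNormSq_le hk hx hs) (Real.exp_nonneg _)).trans
    (le_of_eq ?_)
  rw [← Real.exp_add]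
  congr 1
  field_simp
  ring

theorem measureReal_sketchNormSq_le_le (hk : 0 < k) (hx : 0 < x ⬝ᵥ x) (hε : 0 < ε) (hε1 : ε < 1) :
    (gaussianMatrix k d).real {P | sketchNormSq x P ≤ (1 - ε) * (x ⬝ᵥ x)} ≤
      Real.exp (-(k * ε ^ 2 / 8)) := by
  have hs : |-(ε / 2)| ≤ 1 / 2 := by rw [abs_neg, abs_of_pos] <;> linarith
  have ht : -(ε / 2) * k / (2 * (x ⬝ᵥ x)) ≤ 0 := by
    rw [neg_mul, neg_div, neg_nonpos]
    positivity
  refine (measure_le_le_exp_mul_mgf (t := -(ε / 2) * k / (2 * (x ⬝ᵥ x))) _ ht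
    (mgf_sketchNormSq hk hx (by linarith)).1).trans ?_
  refine (mul_le_mul_of_nonneg_left (mgf_sketchNormSq_le hk hx hs) (Real.exp_nonneg _)).trans
    (le_of_eq ?_)
  rw [← Real.exp_add]
  congr 1
  field_simp
  ring

/-- The sketch `P` preserves the squared norm of `x` up to a relative error `ε`. -/
def IsNormPreserving (ε : ℝ) (x : Fin d → ℝ) (P : Fin k → Fin d → ℝ) : Prop :=
  |sketchNormSq x P - x ⬝ᵥ x| ≤ ε * (x ⬝ᵥ x)

theorem measureReal_not_isNormPreserving_le (hk : 0 < k) (hε : 0 < ε) (hε1 : ε < 1)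
    (x : Fin d → ℝ) :
    (gaussianMatrix k d).real {P | ¬ IsNormPreserving ε x P} ≤
      2 * Real.exp (-(k * ε ^ 2 / 8)) := by
  rcases (dotProduct_self_star_nonneg x : 0 ≤ x ⬝ᵥ x).eq_or_lt with hx | hx
  · have h0 : x = 0 := dotProduct_self_eq_zero.mp hx.symm
    have : {P : Fin k → Fin d → ℝ | ¬ IsNormPreserving ε x P} = ∅ := by
      simp [h0, IsNormPreserving, sketchNormSq]
    rw [this, measureReal_empty]
    positivity
  · calc (gaussianMatrix k d).real {P | ¬ IsNormPreserving ε x P}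
        ≤ (gaussianMatrix k d).real ({P | (1 + ε) * (x ⬝ᵥ x) ≤ sketchNormSq x P} ∪
            {P | sketchNormSq x P ≤ (1 - ε) * (x ⬝ᵥ x)}) := by
          refine measureReal_mono fun P hP ↦ ?_
          simp only [Set.mem_ofPred_eq, IsNormPreserving, not_le, lt_abs] at hP
          rcases hP with hP | hP
          · exact Or.inl (by simp only [Set.mem_ofPred_eq]; linarith)
          · exact Or.inr (by simp only [Set.mem_ofPred_eq]; linarith)
      _ ≤ _ := measureReal_union_le _ _
      _ ≤ _ := by
          linarith [measureReal_sketchNormSq_ge_le hk hx hε hε1,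
            measureReal_sketchNormSq_le_le hk hx hε hε1]

theorem one_sub_le_measure_forall_isNormPreserving {ι : Type*} [Fintype ι] (hk : 0 < k)
    (hε : 0 < ε) (hε1 : ε < 1) (x : ι → Fin d → ℝ) :
    ENNReal.ofReal (1 - Fintype.card ι * (2 * Real.exp (-(k * ε ^ 2 / 8)))) ≤
      gaussianMatrix k d {P | ∀ i, IsNormPreserving ε (x i) P} := by
  set μ := gaussianMatrix k d
  set G := {P : Fin k → Fin d → ℝ | ∀ i, IsNormPreserving ε (x i) P}
  rw [← ofReal_measureReal]
  apply ENNReal.ofReal_le_ofReal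
  have h1 : μ.real Gᶜ ≤ Fintype.card ι * (2 * Real.exp (-(k * ε ^ 2 / 8))) := by
    have : Gᶜ = ⋃ i, {P | ¬ IsNormPreserving ε (x i) P} := by
      ext P
      simp [G]
    rw [this]
    refine (measureReal_iUnion_fintype_le _).trans ?_
    refine (Finset.sum_le_sum fun i _ ↦
      measureReal_not_isNormPreserving_le hk hε hε1 (x i)).trans (le_of_eq ?_)
    simp
  have h2 : (1 : ℝ) ≤ μ.real G + μ.real Gᶜ := by
    rw [← probReal_univ (μ := μ), ← Set.union_compl_self G]
    exact measureReal_union_le _ _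
  linarith

end Concentration

section Deterministic

variable {k d : ℕ} {ε : ℝ} {P : Fin k → Fin d → ℝ}

theorem abs_sketch_dotProduct_sub_le {x y : Fin d → ℝ}
    (hadd : IsNormPreserving ε (√(y ⬝ᵥ y) • x + √(x ⬝ᵥ x) • y) P)
    (hsub : IsNormPreserving ε (√(y ⬝ᵥ y) • x - √(x ⬝ᵥ x) • y) P) :
    |(Matrix.of P *ᵥ x) ⬝ᵥ (Matrix.of P *ᵥ y) - x ⬝ᵥ y| ≤ ε * (√(x ⬝ᵥ x) * √(y ⬝ᵥ y)) := by
  have hx : 0 ≤ x ⬝ᵥ x := dotProduct_self_star_nonneg x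
  have hy : 0 ≤ y ⬝ᵥ y := dotProduct_self_star_nonneg y
  rcases hx.eq_or_lt with hx0 | hx0
  · have h0 : x = 0 := dotProduct_self_eq_zero.mp hx0.symm
    simp [h0]
  rcases hy.eq_or_lt with hy0 | hy0
  · have h0 : y = 0 := dotProduct_self_eq_zero.mp hy0.symm
    simp [h0]
  have ha := Real.sq_sqrt hx
  have hb := Real.sq_sqrt hy
  have ha0 := Real.sqrt_pos.mpr hx0
  have hb0 := Real.sqrt_pos.mpr hy0
  set a := √(x ⬝ᵥ x)
  set b := √(y ⬝ᵥ y)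
  simp only [IsNormPreserving, sketchNormSq, mulVec_add, mulVec_sub, mulVec_smul, dotProduct_add,
    add_dotProduct, dotProduct_sub, sub_dotProduct, smul_dotProduct, dotProduct_smul,
    smul_eq_mul, dotProduct_comm y x,
    dotProduct_comm (Matrix.of P *ᵥ y) (Matrix.of P *ᵥ x), ← ha, ← hb] at hadd hsub
  rw [abs_le] at hadd hsub ⊢
  have hab : 0 < 4 * (a * b) := by positivity
  constructor
  · refine le_of_mul_le_mul_left ?_ hab
    linarith [hadd.1, hsub.2]
  · refine le_of_mul_le_mul_left ?_ hab
    linarith [hadd.2, hsub.1]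

theorem frobNorm_sq_eq_sum_col {n : ℕ} (A : Matrix (Fin d) (Fin n) ℝ) :
    frobNorm A ^ 2 = ∑ i, A.col i ⬝ᵥ A.col i := by
  rw [frobNorm, Real.sq_sqrt (by positivity), Finset.sum_comm]
  simp [dotProduct, sq]

theorem abs_frobNorm_sq_sub_le {n : ℕ} {A : Matrix (Fin d) (Fin n) ℝ}
    (h : ∀ i, IsNormPreserving ε (A.col i) P) :
    |frobNorm (Matrix.of P * A) ^ 2 - frobNorm A ^ 2| ≤ ε * frobNorm A ^ 2 := by
  rw [frobNorm_sq_eq_sum_col, frobNorm_sq_eq_sum_col, ← Finset.sum_sub_distrib, Finset.mul_sum]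
  exact (Finset.abs_sum_le_sum_abs _ _).trans (Finset.sum_le_sum fun i _ ↦ h i)

theorem frobNorm_sketch_mul_sub_le {n : ℕ} {A B : Matrix (Fin d) (Fin n) ℝ} (hε : 0 ≤ ε)
    (hadd : ∀ i j, IsNormPreserving ε (√(B.col j ⬝ᵥ B.col j) • A.col i +
      √(A.col i ⬝ᵥ A.col i) • B.col j) P)
    (hsub : ∀ i j, IsNormPreserving ε (√(B.col j ⬝ᵥ B.col j) • A.col i -
      √(A.col i ⬝ᵥ A.col i) • B.col j) P) :
    frobNorm ((Matrix.of P * A)ᵀ * (Matrix.of P * B) - Aᵀ * B) ≤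
      ε * frobNorm A * frobNorm B := by
  have hA : 0 ≤ frobNorm A := Real.sqrt_nonneg _
  have hB : 0 ≤ frobNorm B := Real.sqrt_nonneg _
  rw [frobNorm]
  refine Real.sqrt_le_iff.mpr ⟨by positivity, ?_⟩
  calc ∑ i, ∑ j, ((Matrix.of P * A)ᵀ * (Matrix.of P * B) - Aᵀ * B) i j ^ 2
      ≤ ∑ i, ∑ j, ε ^ 2 * ((A.col i ⬝ᵥ A.col i) * (B.col j ⬝ᵥ B.col j)) := by
        refine Finset.sum_le_sum fun i _ ↦ Finset.sum_le_sum fun j _ ↦ ?_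
        have h := abs_sketch_dotProduct_sub_le (hadd i j) (hsub i j)
        have h2 := sq_le_sq' (neg_le_of_abs_le h) (le_of_abs_le h)
        rwa [mul_pow, mul_pow, Real.sq_sqrt (by exact dotProduct_self_star_nonneg (A.col i)),
          Real.sq_sqrt (by exact dotProduct_self_star_nonneg (B.col j))] at h2
    _ = (ε * frobNorm A * frobNorm B) ^ 2 := by
        rw [mul_pow, mul_pow, frobNorm_sq_eq_sum_col, frobNorm_sq_eq_sum_col, mul_assoc,
          Finset.sum_mul_sum]
        simp only [Finset.mul_sum]

end Deterministic

theorem union_bound_le {n k : ℕ} {ε δ : ℝ} (hn : 0 < n) (hε : 0 < ε) (hδ : 0 < δ) (hδ1 : δ < 1)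
    (h : 24 * Real.log (2 * n / δ) / ε ^ 2 ≤ k) :
    ((2 * n + 2 * n ^ 2 : ℕ) : ℝ) * (2 * Real.exp (-(k * ε ^ 2 / 8))) ≤ δ := by
  have hn1 : (1 : ℝ) ≤ n := by exact_mod_cast hn
  rw [div_le_iff₀ (by positivity)] at h
  have hexp : Real.exp (-(k * ε ^ 2 / 8)) ≤ (δ / (2 * n)) ^ 3 := by
    rw [← Real.exp_log (show (0 : ℝ) < (δ / (2 * n)) ^ 3 by positivity), Real.exp_le_exp,
      Real.log_pow, ← inv_div (2 * (n : ℝ)), Real.log_inv]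
    push_cast
    linarith
  have hδ3 : δ ^ 3 ≤ δ := pow_le_of_le_one hδ.le hδ1.le (by norm_num)
  calc ((2 * n + 2 * n ^ 2 : ℕ) : ℝ) * (2 * Real.exp (-(k * ε ^ 2 / 8)))
      ≤ (4 * n ^ 3) * (2 * (δ / (2 * n)) ^ 3) := by
        push_cast
        gcongr
        nlinarith [mul_nonneg (sub_nonneg.mpr hn1) (sub_nonneg.mpr hn1),
          mul_nonneg (sq_nonneg (n : ℝ)) (sub_nonneg.mpr hn1)]
    _ = δ ^ 3 := by
        field_simp
        norm_num
    _ ≤ δ := hδ3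

theorem stmt14 :
    ∃ C : ℝ, 0 < C ∧
      ∀ (ε δ : ℝ), 0 < ε → ε < 1 → 0 < δ → δ < 1 →
      ∀ (d n k : ℕ) (A B : Matrix (Fin d) (Fin n) ℝ),
        C * Real.log (2 * n / δ) / ε ^ 2 ≤ k →
        ENNReal.ofReal (1 - δ) ≤
          gaussianMatrix k d
            {P | ((1 - ε) * frobNorm A ^ 2 ≤ frobNorm (Matrix.of P * A) ^ 2 ∧
                  frobNorm (Matrix.of P * A) ^ 2 ≤ (1 + ε) * frobNorm A ^ 2) ∧
                 ((1 - ε) * frobNorm B ^ 2 ≤ frobNorm (Matrix.of P * B) ^ 2 ∧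
                  frobNorm (Matrix.of P * B) ^ 2 ≤ (1 + ε) * frobNorm B ^ 2) ∧
                 frobNorm ((Matrix.of P * A)ᵀ * (Matrix.of P * B) - Aᵀ * B) ≤
                   ε * frobNorm A * frobNorm B} := by
  refine ⟨24, by norm_num, fun ε δ hε hε1 hδ hδ1 d n k A B hC ↦ ?_⟩
  rcases Nat.eq_zero_or_pos n with rfl | hn
  · simp [frobNorm, hδ.le]
  have hk : 0 < k := by
    have hlog : 0 < Real.log (2 * n / δ) := by
      apply Real.log_pos
      rw [one_lt_div hδ]
      have : (1 : ℝ) ≤ n := by exact_mod_cast hn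
      linarith
    exact_mod_cast (show (0 : ℝ) < 24 * Real.log (2 * n / δ) / ε ^ 2 by positivity).trans_le hC
  have hbound := union_bound_le hn hε hδ hδ1 hC
  let a := fun i ↦ √(A.col i ⬝ᵥ A.col i)
  let b := fun j ↦ √(B.col j ⬝ᵥ B.col j)
  let x : (Fin n ⊕ Fin n) ⊕ (Fin n × Fin n ⊕ Fin n × Fin n) → Fin d → ℝ :=
    Sum.elim (Sum.elim A.col B.col)
      (Sum.elim (fun p ↦ b p.2 • A.col p.1 + a p.1 • B.col p.2)
        (fun p ↦ b p.2 • A.col p.1 - a p.1 • B.col p.2))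
  have hcard : Fintype.card ((Fin n ⊕ Fin n) ⊕ (Fin n × Fin n ⊕ Fin n × Fin n)) =
      2 * n + 2 * n ^ 2 := by
    simp only [Fintype.card_sum, Fintype.card_prod, Fintype.card_fin]
    ring
  have hmeas := one_sub_le_measure_forall_isNormPreserving hk hε hε1 x
  rw [hcard] at hmeas
  refine (ENNReal.ofReal_le_ofReal (by linarith)).trans (hmeas.trans (measure_mono fun P hP ↦ ?_))
  have hA := abs_le.mp (abs_frobNorm_sq_sub_le fun i ↦ hP (.inl (.inl i)))
  have hB := abs_le.mp (abs_frobNorm_sq_sub_le fun i ↦ hP (.inl (.inr i)))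
  refine ⟨⟨?_, ?_⟩, ⟨?_, ?_⟩, ?_⟩
  · linarith [hA.1]
  · linarith [hA.2]
  · linarith [hB.1]
  · linarith [hB.2]
  · exact frobNorm_sketch_mul_sub_le hε.le (fun i j ↦ hP (.inr (.inl (i, j))))
      fun i j ↦ hP (.inr (.inr (i, j)))
end

section
/- Let 0 < ε < 1 and 0 < δ < 1 and f ∈ N with f ≥ 1. There exists an absolute constant C > 0 such that if k ≥ C·log(f/δ)/ε², then the k×d random matrix Π with i.i.d. N(0,1/k) entries is a Johnson–Lindenstrauss transform with parameters (ε, δ, f): for every subset V ⊆ R^d with |V| = f, with probability at least 1−δ it holds that |⟨Πv, Πv'⟩ − ⟨v, v'⟩| ≤ ε·‖v‖·‖v'‖ for all v, v' ∈ V. -/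
open MeasureTheory ProbabilityTheory
open scoped NNReal ENNReal RealInnerProductSpace

/-- A finite product of measures with densities is the product measure with the product density. -/
lemma pi_withDensity {ι α : Type*} [Fintype ι] [MeasurableSpace α] {μ : Measure α}
    [IsProbabilityMeasure μ] {g : α → ℝ≥0∞} (hg : Measurable g)
    [SigmaFinite (μ.withDensity g)] :
    Measure.pi (fun _ : ι => μ.withDensity g) =
      (Measure.pi fun _ : ι => μ).withDensity fun x => ∏ i, g (x i) := by
  refine Measure.pi_eq fun s hs => ?_
  rw [withDensity_apply _ (MeasurableSet.univ_pi hs),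
    ← lintegral_indicator (MeasurableSet.univ_pi hs)]
  have hind (x : ι → α) : (Set.univ.pi s).indicator (fun x => ∏ i, g (x i)) x =
      ∏ i, (s i).indicator g (x i) := by
    classical
    by_cases hx : x ∈ Set.univ.pi s
    · rw [Set.indicator_of_mem hx]
      exact Finset.prod_congr rfl fun i _ => (Set.indicator_of_mem (hx i trivial) _).symm
    · rw [Set.indicator_of_notMem hx]
      simp only [Set.mem_univ_pi, not_forall] at hx
      obtain ⟨i, hi⟩ := hx
      exact (Finset.prod_eq_zero (Finset.mem_univ i) (Set.indicator_of_notMem hi _)).symm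
  have hm (i : ι) : Measurable ((s i).indicator g) := hg.indicator (hs i)
  simp_rw [hind]
  rw [lintegral_prod_eq_prod_lintegral_of_indepFun Finset.univ
    (fun i (x : ι → α) => (s i).indicator g (x i))
    (iIndepFun_pi fun i => (hm i).aemeasurable) fun i => (hm i).comp (measurable_pi_apply i)]
  refine Finset.prod_congr rfl fun i _ => ?_
  rw [withDensity_apply _ (hs i), ← lintegral_indicator (hs i),
    ← (measurePreserving_eval (fun _ : ι => μ) i).lintegral_comp (hm i)]

/-- Rescaling a standard Gaussian variable amounts to tilting its law by a quadratic
exponential. -/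
lemma gaussianReal_map_div_sqrt {r : ℝ} (hr : 0 < r) :
    (gaussianReal 0 1).map (· / √r) = (gaussianReal 0 1).withDensity
      fun x => ENNReal.ofReal (Real.exp (Real.log r / 2 - (r - 1) * x ^ 2 / 2)) := by
  have hr' : NNReal.mk (√r ^ 2) (sq_nonneg _) ≠ 0 := by
    rw [← NNReal.coe_ne_zero]; simp [hr.ne', hr.le]
  rw [gaussianReal_map_div_const, zero_div,
    gaussianReal_of_var_ne_zero _ (div_ne_zero one_ne_zero hr'),
    gaussianReal_of_var_ne_zero _ one_ne_zero,
    ← withDensity_mul _ (measurable_gaussianPDF _ _) (by fun_prop)]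
  congr 1
  ext x
  simp only [gaussianPDF, Pi.mul_apply]
  rw [← ENNReal.ofReal_mul (gaussianPDFReal_nonneg _ _ _)]
  congr 1
  have hs : √(2 * Real.pi * (1 / r)) = √(2 * Real.pi) * Real.exp (-(Real.log r / 2)) := by
    rw [Real.sqrt_mul (by positivity), one_div, Real.sqrt_inv, ← neg_div, Real.exp_half,
      Real.exp_neg, Real.exp_log hr, Real.sqrt_inv]
  simp only [gaussianPDFReal, NNReal.coe_div, NNReal.coe_one, NNReal.coe_mk, Real.sq_sqrt hr.le]
  rw [hs, mul_inv, ← Real.exp_neg, mul_assoc, mul_assoc, ← Real.exp_add, mul_one, ← Real.exp_add]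
  congr 2
  field_simp
  ring

/-- The squared Euclidean norm of a vector. -/
def sumSq {k : ℕ} (x : Fin k → ℝ) : ℝ := ∑ i, x i ^ 2

lemma measurable_sumSq {k : ℕ} : Measurable (sumSq (k := k)) := by
  unfold sumSq; fun_prop

/-- The standard Gaussian measure on `Fin k → ℝ`. -/
noncomputable def stdGaussianPi (k : ℕ) : Measure (Fin k → ℝ) :=
  Measure.pi fun _ => gaussianReal 0 1

instance (k : ℕ) : IsProbabilityMeasure (stdGaussianPi k) := by
  unfold stdGaussianPi; infer_instance

lemma stdGaussianPi_map_div_sqrt (k : ℕ) {r : ℝ} (hr : 0 < r) :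
    (stdGaussianPi k).map (fun x i => x i / √r) = (stdGaussianPi k).withDensity
      fun x => ENNReal.ofReal (Real.exp (k * Real.log r / 2 - (r - 1) * sumSq x / 2)) := by
  have hd : Measurable fun x : ℝ => x / √r := by fun_prop
  have hprob : IsProbabilityMeasure ((gaussianReal 0 1).map (· / √r)) :=
    Measure.isProbabilityMeasure_map hd.aemeasurable
  unfold stdGaussianPi
  rw [Measure.pi_map_pi fun _ => hd.aemeasurable]
  rw [gaussianReal_map_div_sqrt hr] at hprob ⊢
  rw [pi_withDensity (by fun_prop)]
  congr 1
  ext x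
  rw [← ENNReal.ofReal_prod_of_nonneg fun _ _ => (Real.exp_pos _).le, ← Real.exp_sum]
  simp [sumSq, Finset.sum_sub_distrib, Finset.mul_sum, Finset.sum_div, mul_div_assoc]

lemma sumSq_div_sqrt {k : ℕ} {r : ℝ} (hr : 0 < r) (x : Fin k → ℝ) :
    sumSq (fun i => x i / √r) = sumSq x / r := by
  simp [sumSq, div_pow, Real.sq_sqrt hr.le, Finset.sum_div]

/-- If the density of a dilate is at most `exp c` where `sumSq ∈ A`, dilating the set
increases its Gaussian measure by a factor at most `exp c`. -/
lemma measureReal_sumSq_div_le {k : ℕ} {r c : ℝ} (hr : 0 < r) {A : Set ℝ} (hA : MeasurableSet A)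
    (h : ∀ s ∈ A, k * Real.log r / 2 - (r - 1) * s / 2 ≤ c) :
    (stdGaussianPi k).real {x | sumSq x / r ∈ A} ≤
      Real.exp c * (stdGaussianPi k).real {x | sumSq x ∈ A} := by
  have hA' : MeasurableSet {x : Fin k → ℝ | sumSq x ∈ A} := measurable_sumSq hA
  have key : stdGaussianPi k {x | sumSq x / r ∈ A} ≤
      ENNReal.ofReal (Real.exp c) * stdGaussianPi k {x | sumSq x ∈ A} := by
    have := congrArg (fun μ => μ {x | sumSq x ∈ A}) (stdGaussianPi_map_div_sqrt k hr)
    rw [Measure.map_apply (by fun_prop) hA', withDensity_apply _ hA'] at this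
    have hpre : (fun (x : Fin k → ℝ) i => x i / √r) ⁻¹' {x | sumSq x ∈ A} =
        {x | sumSq x / r ∈ A} := by
      ext x; simp [sumSq_div_sqrt hr]
    rw [← hpre, this, ← setLIntegral_const]
    exact setLIntegral_mono measurable_const fun x hx =>
      ENNReal.ofReal_le_ofReal (Real.exp_le_exp.2 (h _ hx))
  have := ENNReal.toReal_mono (ENNReal.mul_ne_top ENNReal.ofReal_ne_top (measure_ne_top _ _)) key
  rwa [ENNReal.toReal_mul, ENNReal.toReal_ofReal (Real.exp_pos _).le] at this

lemma measureReal_sumSq_le {k : ℕ} {r c : ℝ} (hr : 0 < r) {A : Set ℝ} (hA : MeasurableSet A)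
    (h : ∀ s ∈ A, c ≤ k * Real.log r / 2 - (r - 1) * s / 2) :
    (stdGaussianPi k).real {x | sumSq x ∈ A} ≤ Real.exp (-c) := by
  have hA' : MeasurableSet {x : Fin k → ℝ | sumSq x ∈ A} := measurable_sumSq hA
  have key : ENNReal.ofReal (Real.exp c) * stdGaussianPi k {x | sumSq x ∈ A} ≤ 1 := by
    rw [← setLIntegral_const]
    calc _ ≤ ∫⁻ x in {x : Fin k → ℝ | sumSq x ∈ A}, ENNReal.ofReal
          (Real.exp (k * Real.log r / 2 - (r - 1) * sumSq x / 2)) ∂stdGaussianPi k :=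
          setLIntegral_mono (by have := measurable_sumSq (k := k); fun_prop) fun x hx =>
            ENNReal.ofReal_le_ofReal (Real.exp_le_exp.2 (h _ hx))
      _ ≤ 1 := by
          rw [← withDensity_apply _ hA', ← stdGaussianPi_map_div_sqrt k hr,
            Measure.map_apply (by fun_prop) hA']
          exact prob_le_one
  have := ENNReal.toReal_mono ENNReal.one_ne_top key
  rw [ENNReal.toReal_mul, ENNReal.toReal_ofReal (Real.exp_pos _).le, ENNReal.toReal_one] at this
  rwa [Real.exp_neg, ← one_div, le_div_iff₀' (Real.exp_pos _)]

/-- A combination of i.i.d. centred Gaussians with unit total variance is standard Gaussian. -/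
lemma pi_gaussianReal_map_sum_mul {d : ℕ} (a : Fin d → ℝ) (v : ℝ≥0) (h : (∑ j, a j ^ 2) * v = 1) :
    (Measure.pi fun _ : Fin d => gaussianReal 0 v).map (fun x => ∑ j, a j * x j) =
      gaussianReal 0 1 := by
  have hm : Measurable fun (x : Fin d → ℝ) j => a j * x j := by fun_prop
  have hs : Measurable fun x : Fin d → ℝ => ∑ j, x j := by fun_prop
  have hcomp : (fun x : Fin d → ℝ => ∑ j, a j * x j) =
      (fun x : Fin d → ℝ => ∑ j, x j) ∘ fun x j => a j * x j := rfl
  rw [hcomp, ← Measure.map_map hs hm]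
  have (j : Fin d) : SigmaFinite ((gaussianReal 0 v).map (a j * ·)) := by
    rw [gaussianReal_map_const_mul]; infer_instance
  rw [Measure.pi_map_pi (f := fun j y => a j * y) fun j => by fun_prop]
  have : IsProbabilityMeasure ((Measure.pi fun j => (gaussianReal 0 v).map (a j * ·)).map
      fun x : Fin d → ℝ => ∑ j, x j) := by
    simp_rw [gaussianReal_map_const_mul]
    exact Measure.isProbabilityMeasure_map hs.aemeasurable
  refine Measure.ext_of_charFun ?_
  simp_rw [gaussianReal_map_const_mul]
  rw [charFun_map_sum_pi_eq_prod]
  ext t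
  simp only [Finset.prod_apply, charFun_gaussianReal]
  rw [← Complex.exp_sum]
  congr 1
  have h' : (∑ j, (a j : ℂ) ^ 2) * v = 1 := by exact_mod_cast h
  simp only [mul_zero, Complex.ofReal_zero, zero_mul, zero_sub, NNReal.coe_mul, NNReal.coe_mk,
    Complex.ofReal_mul, Complex.ofReal_pow, NNReal.coe_one, Complex.ofReal_one, one_mul,
    Finset.sum_neg_distrib, ← Finset.sum_mul, ← Finset.sum_div]
  linear_combination (-(t : ℂ) ^ 2 / 2) * h'

lemma sub_two_mul_sq_le_log_one_add {u : ℝ} (hu : -(1 / 2) ≤ u) :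
    u - 2 * u ^ 2 ≤ Real.log (1 + u) := by
  have hpos : 0 < 1 + u := by linarith
  refine le_trans ?_ (Real.one_sub_inv_le_log_of_pos hpos)
  rw [← sub_nonneg]
  have : 1 - (1 + u)⁻¹ - (u - 2 * u ^ 2) = u ^ 2 * (1 + 2 * u) / (1 + u) := by
    field_simp; ring
  rw [this]
  have : 0 ≤ 1 + 2 * u := by linarith
  positivity

lemma measureReal_le_mul_sub_sumSq_le {k : ℕ} {u t : ℝ} (hu : -(1 / 2) ≤ u) :
    (stdGaussianPi k).real {x | t ≤ u * (k - sumSq x)} ≤ Real.exp (-(t / 2 - k * u ^ 2)) := by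
  refine measureReal_sumSq_le (r := 1 + u) (A := {s | t ≤ u * (k - s)}) (by linarith)
    (measurableSet_le (by fun_prop) (by fun_prop)) fun s hs => ?_
  have := mul_le_mul_of_nonneg_left (sub_two_mul_sq_le_log_one_add hu) (Nat.cast_nonneg (α := ℝ) k)
  have hs' : t ≤ u * (k - s) := hs
  linarith

lemma measureReal_lt_abs_sumSq_sub_le {k : ℕ} {a t : ℝ} (ha : 0 ≤ a) (ha' : a ≤ 1 / 2) :
    (stdGaussianPi k).real {x | t < |sumSq x - k|} ≤ 2 * Real.exp (-(a * t / 2 - k * a ^ 2)) := by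
  have h₁ := measureReal_le_mul_sub_sumSq_le (k := k) (u := a) (t := a * t) (by linarith)
  have h₂ := measureReal_le_mul_sub_sumSq_le (k := k) (u := -a) (t := a * t) (by linarith)
  have hsub : {x : Fin k → ℝ | t < |sumSq x - k|} ⊆
      {x | a * t ≤ a * (k - sumSq x)} ∪ {x | a * t ≤ -a * (k - sumSq x)} := by
    intro x hx
    rcases lt_abs.1 (Set.mem_ofPred.1 hx) with h | h
    · exact Or.inr (by simp only [Set.mem_ofPred]; nlinarith)
    · exact Or.inl (by simp only [Set.mem_ofPred]; nlinarith)
  refine (measureReal_mono hsub).trans ((measureReal_union_le _ _).trans ?_)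
  rw [neg_sq] at h₂
  linarith

/-- Chernoff bound for the chi-squared distribution. -/
lemma measureReal_mul_lt_abs_sumSq_sub_le (k : ℕ) {ε : ℝ} (hε : 0 < ε) (hε' : ε < 1) :
    (stdGaussianPi k).real {x | ε * k < |sumSq x - k|} ≤ 2 * Real.exp (-(k * ε ^ 2 / 16)) := by
  convert measureReal_lt_abs_sumSq_sub_le (k := k) (a := ε / 4) (t := ε * k) (by linarith)
    (by linarith) using 3
  ring

lemma exp_neg_log_four : Real.exp (-Real.log 4) = 1 / 4 := by
  rw [Real.exp_neg, Real.exp_log (by norm_num), one_div]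

lemma measureReal_sumSq_lt_div_le {k : ℕ} (hk : 1 ≤ k) :
    (stdGaussianPi k).real {x | sumSq x < k / 63} ≤ 1 / 4 := by
  rw [← exp_neg_log_four]
  refine measureReal_sumSq_le (r := 64) (A := {s | s < k / 63}) (by norm_num)
    (measurableSet_lt (by fun_prop) (by fun_prop)) fun s (hs : s < k / 63) => ?_
  have h4 : Real.log 4 = 2 * Real.log 2 := by
    rw [show (4 : ℝ) = 2 ^ 2 by norm_num, Real.log_pow]; norm_num
  have h64 : Real.log 64 = 6 * Real.log 2 := by
    rw [show (64 : ℝ) = 2 ^ 6 by norm_num, Real.log_pow]; norm_num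
  have hk' : (1 : ℝ) ≤ k := by exact_mod_cast hk
  rw [h4, h64]
  nlinarith [Real.log_two_gt_d9]

lemma exp_neg_seven_fourths_le : Real.exp (-(7 / 4)) ≤ 1 / 4 := by
  rw [← exp_neg_log_four, Real.exp_le_exp, show (4 : ℝ) = 2 ^ 2 by norm_num, Real.log_pow]
  norm_num
  linarith [Real.log_two_lt_d9]

lemma quarter_le_measureReal_sumSq {k : ℕ} (hk : 1 ≤ k) :
    1 / 4 ≤ (stdGaussianPi k).real {x | |sumSq x - k| ≤ 8 * √k ∧ k / 63 ≤ sumSq x} := by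
  have hk' : (1 : ℝ) ≤ k := by exact_mod_cast hk
  have hs : 1 ≤ √(k : ℝ) := Real.one_le_sqrt.2 hk'
  have hsq : √(k : ℝ) ^ 2 = k := Real.sq_sqrt (by linarith)
  have h₁ := measureReal_lt_abs_sumSq_sub_le (k := k) (a := 1 / (2 * √k)) (t := 8 * √k)
    (by positivity) (by rw [div_le_div_iff₀ (by positivity) (by norm_num)]; linarith)
  have he : 1 / (2 * √(k : ℝ)) * (8 * √k) / 2 - k * (1 / (2 * √k)) ^ 2 = 7 / 4 := by
    rw [← hsq, Real.sqrt_sq (by positivity)]; field_simp; norm_num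
  rw [he] at h₁
  have h₂ := measureReal_sumSq_lt_div_le hk
  have hcover : (Set.univ : Set (Fin k → ℝ)) ⊆
      {x | |sumSq x - k| ≤ 8 * √k ∧ k / 63 ≤ sumSq x} ∪
        ({x | 8 * √k < |sumSq x - k|} ∪ {x | sumSq x < k / 63}) := by
    intro x _
    simp only [Set.mem_union, Set.mem_ofPred]
    by_contra! h
    exact absurd (h.1 h.2.1) (not_lt.2 h.2.2)
  have := (measureReal_mono (μ := stdGaussianPi k) hcover).trans ((measureReal_union_le _ _).trans
    (add_le_add_right (measureReal_union_le _ _) _))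
  rw [probReal_univ] at this
  linarith [exp_neg_seven_fourths_le]

/-- Lower bound for the probability that a chi-squared variable is close to its mean, in the
regime where the Chernoff bound is vacuous. -/
lemma sqrt_mul_le_measureReal_abs_sumSq_sub_le {k : ℕ} (hk : 1 ≤ k) {ε : ℝ} (hε : 0 < ε)
    (hε' : ε < 1) (hτ : √k * ε ≤ 6) :
    √k * ε ≤ 8184 * Real.exp 42 * (stdGaussianPi k).real {x | |sumSq x - k| ≤ ε * k} := by
  have hk' : (1 : ℝ) ≤ k := by exact_mod_cast hk
  have hs : 1 ≤ √(k : ℝ) := Real.one_le_sqrt.2 hk'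
  have hsq : √(k : ℝ) ^ 2 = k := Real.sq_sqrt (by linarith)
  set p := (stdGaussianPi k).real {x | |sumSq x - k| ≤ ε * k} with hp
  set h := ε / 126 with hh
  have hh0 : 0 < h := by positivity
  set M := ⌈8 / (√k * h)⌉₊ + 1 with hM
  have hM₁ : 8 / (√k * h) + 1 ≤ M := by
    rw [hM]; push_cast; linarith [Nat.le_ceil (8 / (√k * h))]
  have hM₂ : (M : ℝ) ≤ 8 / (√k * h) + 2 := by
    rw [hM]; push_cast; linarith [Nat.ceil_lt_add_one (a := 8 / (√k * h)) (by positivity)]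
  have hMh : M * h ≤ 8 / √k + ε := by
    calc M * h ≤ (8 / (√k * h) + 2) * h := by gcongr
      _ = 8 / √k + 2 * h := by field_simp
      _ ≤ _ := by rw [hh]; linarith
  set J := (Finset.Icc (-(M : ℤ)) M).filter fun j : ℤ => 0 < 1 + j * h with hJ
  have hcard : (J.card : ℝ) ≤ 2046 / (√k * ε) := by
    have h₁ : J.card ≤ 2 * M + 1 := by
      refine (Finset.card_filter_le _ _).trans ?_
      rw [Int.card_Icc]; omega
    have h₂ : (J.card : ℝ) ≤ 2 * M + 1 := by exact_mod_cast h₁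
    have h₃ : 8 / (√k * h) = 1008 / (√k * ε) := by rw [hh]; field_simp; norm_num
    have h₄ : 5 ≤ 30 / (√k * ε) := by
      rw [le_div_iff₀ (by positivity)]; linarith
    have h₅ : 2046 / (√k * ε) = 2 * (1008 / (√k * ε)) + 30 / (√k * ε) := by ring
    linarith
  have hdil : ∀ j ∈ J, (stdGaussianPi k).real {x | |sumSq x / (1 + j * h) - k| ≤ ε * k} ≤
      Real.exp 42 * p := by
    intro j hj
    rw [hJ, Finset.mem_filter, Finset.mem_Icc] at hj
    refine measureReal_sumSq_div_le (A := {s | |s - k| ≤ ε * k}) hj.2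
      (measurableSet_le (by fun_prop) (by fun_prop)) fun s (hs' : |s - k| ≤ ε * k) => ?_
    have hlog := mul_le_mul_of_nonneg_left (Real.log_le_sub_one_of_pos hj.2)
      (Nat.cast_nonneg (α := ℝ) k)
    have hjM : |(j : ℝ)| ≤ M := by
      rw [abs_le]; exact_mod_cast hj.1
    have hjh : |(j : ℝ) * h| ≤ 8 / √k + ε := by
      rw [abs_mul, abs_of_pos hh0]
      exact (mul_le_mul_of_nonneg_right hjM hh0.le).trans hMh
    have hprod : (j * h) * (k - s) ≤ (8 / √k + ε) * (ε * k) :=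
      calc _ ≤ |(j : ℝ) * h * (k - s)| := le_abs_self _
        _ = |(j : ℝ) * h| * |s - k| := by rw [abs_mul, abs_sub_comm s]
        _ ≤ _ := by gcongr
    have heq : (8 / √k + ε) * (ε * k) = 8 * (√k * ε) + (√k * ε) ^ 2 := by
      rw [← hsq, Real.sqrt_sq (by positivity)]; field_simp
    have : (√k * ε) ^ 2 ≤ 6 ^ 2 := by gcongr
    linarith
  have hcover : {x : Fin k → ℝ | |sumSq x - k| ≤ 8 * √k ∧ k / 63 ≤ sumSq x} ⊆
      ⋃ j ∈ J, {x | |sumSq x / (1 + j * h) - k| ≤ ε * k} := by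
    rintro x ⟨hx₁, hx₂⟩
    set s := sumSq x
    set y := (s / k - 1) / h with hy
    have hsy : s = k * (1 + y * h) := by rw [hy]; field_simp; ring
    have hy' : |y| ≤ 8 / (√k * h) := by
      have : y = (s - k) / (k * h) := by rw [hy]; field_simp
      rw [this, abs_div, abs_of_pos (by positivity : (k : ℝ) * h > 0),
        div_le_div_iff₀ (by positivity) (by positivity)]
      calc |s - k| * (√k * h) ≤ 8 * √k * (√k * h) := by gcongr
        _ = 8 * (√k ^ 2 * h) := by ring
        _ = _ := by rw [hsq]
    obtain ⟨hy₁, hy₂⟩ := abs_le.1 hy'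
    have hf₁ := Int.floor_le y
    have hf₂ := Int.lt_floor_add_one y
    have hlow : 1 / 63 ≤ 1 + y * h := by
      rw [hsy] at hx₂
      exact le_of_mul_le_mul_left (by linarith) (by linarith : (0 : ℝ) < k)
    have hdiff : y * h - ⌊y⌋ * h ≤ h := by nlinarith
    have hdiff' : ⌊y⌋ * h ≤ y * h := by gcongr
    have hr : 1 / 126 ≤ 1 + ⌊y⌋ * h := by linarith
    refine Set.mem_biUnion (x := ⌊y⌋) ?_ ?_
    · simp only [hJ, Finset.coe_filter, Finset.mem_Icc, Set.mem_ofPred]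
      refine ⟨⟨?_, ?_⟩, by linarith⟩
      · have : -(M : ℝ) ≤ ⌊y⌋ := by linarith
        exact_mod_cast this
      · have : (⌊y⌋ : ℝ) ≤ M := by linarith
        exact_mod_cast this
    · change |s / (1 + ⌊y⌋ * h) - k| ≤ ε * k
      have hr0 : 0 < 1 + ⌊y⌋ * h := by linarith
      have : s / (1 + ⌊y⌋ * h) - k = k * (y * h - ⌊y⌋ * h) / (1 + ⌊y⌋ * h) := by
        rw [hsy, eq_div_iff hr0.ne', sub_mul, div_mul_cancel₀ _ hr0.ne']; ring
      rw [this, abs_of_nonneg (div_nonneg (mul_nonneg (by linarith) (by linarith)) hr0.le),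
        div_le_iff₀ hr0]
      calc k * (y * h - ⌊y⌋ * h) ≤ k * h := by gcongr
        _ = ε * k * (1 / 126) := by rw [hh]; ring
        _ ≤ _ := by gcongr
  have hfin : 1 / 4 ≤ 2046 / (√k * ε) * (Real.exp 42 * p) :=
    calc (1 / 4 : ℝ) ≤ _ := quarter_le_measureReal_sumSq hk
      _ ≤ _ := measureReal_mono hcover (measure_ne_top _ _)
      _ ≤ ∑ j ∈ J, (stdGaussianPi k).real {x | |sumSq x / (1 + j * h) - k| ≤ ε * k} :=
        measureReal_biUnion_finset_le _ _
      _ ≤ J.card • (Real.exp 42 * p) := Finset.sum_le_card_nsmul _ _ _ hdil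
      _ ≤ _ := by
        rw [nsmul_eq_mul]
        gcongr
  rw [div_mul_eq_mul_div, le_div_iff₀ (by positivity)] at hfin
  linarith

instance (k d : ℕ) : IsProbabilityMeasure (gaussianMatrix k d) := by
  unfold gaussianMatrix; infer_instance

/-- For a fixed nonzero vector `w`, the ratio `k * ‖Π w‖ ^ 2 / ‖w‖ ^ 2` is chi-squared
distributed with `k` degrees of freedom. -/
lemma gaussianMatrix_real_norm_sq_mem {k d : ℕ} (hk : 1 ≤ k) {w : EuclideanSpace ℝ (Fin d)}
    (hw : w ≠ 0) {A : Set ℝ} (hA : MeasurableSet A) :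
    (gaussianMatrix k d).real
        {P | k * ‖Matrix.toEuclideanLin (Matrix.of P) w‖ ^ 2 / ‖w‖ ^ 2 ∈ A} =
      (stdGaussianPi k).real {x | sumSq x ∈ A} := by
  have hk' : (0 : ℝ) < k := by exact_mod_cast hk
  have hw' : 0 < ‖w‖ := norm_pos_iff.2 hw
  set a : Fin d → ℝ := fun j => √k * w j / ‖w‖ with ha
  have hsum : (∑ j, a j ^ 2) * ((k : ℝ≥0)⁻¹ : ℝ≥0) = 1 := by
    have : ∑ j, a j ^ 2 = k * (∑ j, w j ^ 2) / ‖w‖ ^ 2 := by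
      simp only [ha, div_pow, mul_pow, Real.sq_sqrt hk'.le, Finset.mul_sum, Finset.sum_div]
    rw [this, ← EuclideanSpace.real_norm_sq_eq]
    push_cast
    field_simp
  have hm : Measurable fun y : Fin d → ℝ => ∑ j, a j * y j := by fun_prop
  have hlaw : (gaussianMatrix k d).map (fun P i => ∑ j, a j * P i j) = stdGaussianPi k := by
    unfold gaussianMatrix stdGaussianPi
    have hrow := pi_gaussianReal_map_sum_mul a _ hsum
    have (_ : Fin k) : SigmaFinite ((Measure.pi fun _ : Fin d => gaussianReal 0 (k : ℝ≥0)⁻¹).map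
        fun y => ∑ j, a j * y j) := by
      rw [hrow]; infer_instance
    rw [Measure.pi_map_pi (f := fun _ (y : Fin d → ℝ) => ∑ j, a j * y j) fun _ => hm.aemeasurable]
    simp_rw [hrow]
  have hA' : MeasurableSet {x : Fin k → ℝ | sumSq x ∈ A} := measurable_sumSq hA
  have hpre : {P : Fin k → Fin d → ℝ |
      k * ‖Matrix.toEuclideanLin (Matrix.of P) w‖ ^ 2 / ‖w‖ ^ 2 ∈ A} =
      (fun P i => ∑ j, a j * P i j) ⁻¹' {x | sumSq x ∈ A} := by
    ext P
    have : k * ‖Matrix.toEuclideanLin (Matrix.of P) w‖ ^ 2 / ‖w‖ ^ 2 =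
        sumSq fun i => ∑ j, a j * P i j := by
      have hi (i : Fin k) : ∑ j, a j * P i j =
          √k / ‖w‖ * Matrix.toEuclideanLin (Matrix.of P) w i := by
        simp only [ha, Matrix.toLpLin_apply, Matrix.mulVec, dotProduct, Matrix.of_apply,
          Finset.mul_sum]
        exact Finset.sum_congr rfl fun j _ => by ring
      simp only [sumSq, hi, mul_pow, div_pow, Real.sq_sqrt hk'.le, ← Finset.mul_sum,
        ← EuclideanSpace.real_norm_sq_eq]
      ring
    simp only [Set.mem_ofPred, Set.mem_preimage, this]
  rw [hpre, measureReal_def, ← Measure.map_apply (by fun_prop) hA', hlaw, measureReal_def]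

lemma abs_norm_sq_sub_le_iff {k : ℕ} (hk : 1 ≤ k) {a b ε : ℝ} (hb : 0 < b) :
    |a ^ 2 - b ^ 2| ≤ ε * b ^ 2 ↔ |k * a ^ 2 / b ^ 2 - k| ≤ ε * k := by
  have hk' : (0 : ℝ) < k := by exact_mod_cast hk
  have : k * a ^ 2 / b ^ 2 - k = (a ^ 2 - b ^ 2) * (k / b ^ 2) := by field_simp
  rw [this, abs_mul, abs_of_pos (by positivity : k / b ^ 2 > 0), ← mul_div_assoc,
    div_le_iff₀ (by positivity)]
  constructor <;> intro h <;> nlinarith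

/-- The distributional Johnson–Lindenstrauss lemma. -/
lemma gaussianMatrix_real_lt_abs_norm_sq_sub_le {k d : ℕ} (hk : 1 ≤ k) {ε : ℝ} (hε : 0 < ε)
    (hε' : ε < 1) (w : EuclideanSpace ℝ (Fin d)) :
    (gaussianMatrix k d).real
        {P | ε * ‖w‖ ^ 2 < |‖Matrix.toEuclideanLin (Matrix.of P) w‖ ^ 2 - ‖w‖ ^ 2|} ≤
      2 * Real.exp (-(k * ε ^ 2 / 16)) := by
  rcases eq_or_ne w 0 with rfl | hw
  · simp only [map_zero, norm_zero]
    norm_num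
    positivity
  · refine le_trans (le_of_eq ?_) (measureReal_mul_lt_abs_sumSq_sub_le k hε hε')
    refine Eq.trans ?_ (gaussianMatrix_real_norm_sq_mem hk hw (A := {s | ε * k < |s - k|})
      (measurableSet_lt (by fun_prop) (by fun_prop)))
    congr 1
    ext P
    exact not_le.symm.trans ((abs_norm_sq_sub_le_iff hk (norm_pos_iff.2 hw)).not.trans not_le)

/-- If `T` nearly preserves the norms of the sum and the difference of the normalized vectors
`v / ‖v‖` and `v' / ‖v'‖`, then it nearly preserves the inner product of `v` and `v'`. -/
lemma abs_inner_map_sub_inner_le {E F : Type*} [NormedAddCommGroup E] [InnerProductSpace ℝ E]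
    [NormedAddCommGroup F] [InnerProductSpace ℝ F] (T : E →ₗ[ℝ] F) {ε : ℝ} (hε : 0 ≤ ε) (v v' : E)
    (h₁ : |‖T (‖v‖⁻¹ • v + ‖v'‖⁻¹ • v')‖ ^ 2 - ‖‖v‖⁻¹ • v + ‖v'‖⁻¹ • v'‖ ^ 2| ≤
      ε * ‖‖v‖⁻¹ • v + ‖v'‖⁻¹ • v'‖ ^ 2)
    (h₂ : |‖T (‖v‖⁻¹ • v - ‖v'‖⁻¹ • v')‖ ^ 2 - ‖‖v‖⁻¹ • v - ‖v'‖⁻¹ • v'‖ ^ 2| ≤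
      ε * ‖‖v‖⁻¹ • v - ‖v'‖⁻¹ • v'‖ ^ 2) :
    |⟪T v, T v'⟫ - ⟪v, v'⟫| ≤ ε * ‖v‖ * ‖v'‖ := by
  have hnorm (x : E) : x = ‖x‖ • (‖x‖⁻¹ • x) := by
    rcases eq_or_ne x 0 with rfl | hx
    · simp
    · rw [smul_smul, mul_inv_cancel₀ (norm_ne_zero_iff.2 hx), one_smul]
  have hle (x : E) : ‖‖x‖⁻¹ • x‖ ^ 2 ≤ 1 := by
    rw [norm_smul, norm_inv, norm_norm]
    exact pow_le_one₀ (by positivity) (inv_mul_le_one)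
  have hu := hle v
  have hu' := hle v'
  have hv := hnorm v
  have hv' := hnorm v'
  set u := ‖v‖⁻¹ • v
  set u' := ‖v'‖⁻¹ • v'
  have key : |⟪T u, T u'⟫ - ⟪u, u'⟫| ≤ ε := by
    rw [map_add, norm_add_sq_real, norm_add_sq_real] at h₁
    rw [map_sub, norm_sub_sq_real, norm_sub_sq_real] at h₂
    rw [abs_le] at *
    constructor <;> nlinarith
  have : ⟪T v, T v'⟫ - ⟪v, v'⟫ = ‖v‖ * ‖v'‖ * (⟪T u, T u'⟫ - ⟪u, u'⟫) := by
    conv_lhs => rw [hv, hv']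
    simp only [map_smul, real_inner_smul_left, real_inner_smul_right]
    ring
  rw [this, abs_mul, abs_of_nonneg (by positivity)]
  calc _ ≤ ‖v‖ * ‖v'‖ * ε := by gcongr
    _ = _ := by ring

/-- The set of matrices that are `ε`-isometric on a finite set of vectors. -/
def jlSet {d : ℕ} (k : ℕ) (ε : ℝ) (V : Finset (EuclideanSpace ℝ (Fin d))) :
    Set (Fin k → Fin d → ℝ) :=
  {P | ∀ v ∈ V, ∀ v' ∈ V, |⟪Matrix.toEuclideanLin (Matrix.of P) v,
    Matrix.toEuclideanLin (Matrix.of P) v'⟫ - ⟪v, v'⟫| ≤ ε * ‖v‖ * ‖v'‖}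

/-- Union bound over all pairs of vectors. -/
lemma one_sub_le_gaussianMatrix_real_jlSet {k d : ℕ} (hk : 1 ≤ k) {ε : ℝ} (hε : 0 < ε)
    (hε' : ε < 1) (V : Finset (EuclideanSpace ℝ (Fin d))) :
    1 - 4 * V.card ^ 2 * Real.exp (-(k * ε ^ 2 / 16)) ≤
      (gaussianMatrix k d).real (jlSet k ε V) := by
  let bad (w : EuclideanSpace ℝ (Fin d)) : Set (Fin k → Fin d → ℝ) :=
    {P | ε * ‖w‖ ^ 2 < |‖Matrix.toEuclideanLin (Matrix.of P) w‖ ^ 2 - ‖w‖ ^ 2|}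
  let badPair (q : EuclideanSpace ℝ (Fin d) × EuclideanSpace ℝ (Fin d)) :=
    bad (‖q.1‖⁻¹ • q.1 + ‖q.2‖⁻¹ • q.2) ∪ bad (‖q.1‖⁻¹ • q.1 - ‖q.2‖⁻¹ • q.2)
  have hbad (q) : (gaussianMatrix k d).real (badPair q) ≤
      4 * Real.exp (-(k * ε ^ 2 / 16)) := by
    refine (measureReal_union_le _ _).trans ?_
    have h (w) : (gaussianMatrix k d).real (bad w) ≤ 2 * Real.exp (-(k * ε ^ 2 / 16)) :=
      gaussianMatrix_real_lt_abs_norm_sq_sub_le hk hε hε' w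
    linarith [h (‖q.1‖⁻¹ • q.1 + ‖q.2‖⁻¹ • q.2), h (‖q.1‖⁻¹ • q.1 - ‖q.2‖⁻¹ • q.2)]
  have hcover : (Set.univ : Set (Fin k → Fin d → ℝ)) ⊆
      jlSet k ε V ∪ ⋃ q ∈ V ×ˢ V, badPair q := by
    intro P _
    by_contra! hP
    simp only [Set.mem_union, Set.mem_iUnion, not_or, not_exists] at hP
    refine hP.1 fun v hv v' hv' => ?_
    have := hP.2 (v, v') (Finset.mk_mem_product hv hv')
    simp only [badPair, bad, Set.mem_union, not_or, Set.mem_ofPred, not_lt] at this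
    exact abs_inner_map_sub_inner_le _ hε.le v v' this.1 this.2
  have hsum := (measureReal_biUnion_finset_le (μ := gaussianMatrix k d) (V ×ˢ V) badPair).trans
    (Finset.sum_le_card_nsmul _ _ _ fun q _ => hbad q)
  have := (measureReal_mono (μ := gaussianMatrix k d) hcover (measure_ne_top _ _)).trans
    (measureReal_union_le _ _)
  rw [probReal_univ] at this
  rw [Finset.card_product, nsmul_eq_mul] at hsum
  push_cast at hsum
  linarith

lemma gaussianMatrix_real_jlSet_singleton {k d : ℕ} (hk : 1 ≤ k) (ε : ℝ)
    {v : EuclideanSpace ℝ (Fin d)} (hv : v ≠ 0) :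
    (gaussianMatrix k d).real (jlSet k ε {v}) =
      (stdGaussianPi k).real {x | |sumSq x - k| ≤ ε * k} := by
  refine Eq.trans ?_ (gaussianMatrix_real_norm_sq_mem hk hv (A := {s | |s - k| ≤ ε * k})
    (measurableSet_le (by fun_prop) (by fun_prop)))
  congr 1
  ext P
  simp only [jlSet, Finset.mem_singleton, forall_eq, Set.mem_ofPred, real_inner_self_eq_norm_sq]
  rw [mul_assoc, ← sq]
  exact abs_norm_sq_sub_le_iff hk (norm_pos_iff.2 hv)

/-- The case of a single vector and a large failure probability, in which no union bound
argument applies. -/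
lemma one_sub_le_gaussianMatrix_real_jlSet_singleton {k d : ℕ} (hk : 1 ≤ k) {ε δ : ℝ}
    (hε : 0 < ε) (hε' : ε < 1) (hδ : 1 / 2 < δ)
    (h : 50000 * Real.exp 42 * (1 - δ) ≤ k * ε ^ 2) (v : EuclideanSpace ℝ (Fin d)) :
    1 - δ ≤ (gaussianMatrix k d).real (jlSet k ε {v}) := by
  rcases eq_or_ne v 0 with rfl | hv
  · have : jlSet k ε {(0 : EuclideanSpace ℝ (Fin d))} = Set.univ := by
      ext P; simp [jlSet]
    rw [this, probReal_univ]
    linarith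
  have hsq : (√k * ε) ^ 2 = k * ε ^ 2 := by rw [mul_pow, Real.sq_sqrt (Nat.cast_nonneg k)]
  rcases le_total (√k * ε) 6 with hτ | hτ
  · have hp := sqrt_mul_le_measureReal_abs_sumSq_sub_le hk hε hε' hτ
    rw [← gaussianMatrix_real_jlSet_singleton hk ε hv] at hp
    have h0 : 0 ≤ √k * ε := by positivity
    have hexp := Real.exp_pos 42
    have hp0 : 0 ≤ (gaussianMatrix k d).real (jlSet k ε {v}) := measureReal_nonneg
    have : 50000 * Real.exp 42 * (1 - δ) ≤
        50000 * Real.exp 42 * (gaussianMatrix k d).real (jlSet k ε {v}) := by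
      have := mul_nonneg hexp.le hp0
      nlinarith
    exact le_of_mul_le_mul_left this (by positivity)
  · have h36 : 36 ≤ k * ε ^ 2 := by nlinarith
    have hJL := measureReal_mul_lt_abs_sumSq_sub_le k hε hε'
    have hexp : Real.exp (-(k * ε ^ 2 / 16)) ≤ 1 / 4 :=
      (Real.exp_le_exp.2 (by linarith)).trans exp_neg_seven_fourths_le
    have hA : MeasurableSet {x : Fin k → ℝ | |sumSq x - k| ≤ ε * k} :=
      measurableSet_le (by have := measurable_sumSq (k := k); fun_prop) (by fun_prop)
    have hc := probReal_compl_eq_one_sub (μ := stdGaussianPi k) hA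
    have hset : {x : Fin k → ℝ | |sumSq x - k| ≤ ε * k}ᶜ = {x | ε * k < |sumSq x - k|} := by
      ext x; simp
    rw [hset] at hc
    rw [gaussianMatrix_real_jlSet_singleton hk ε hv]
    linarith

theorem stmt16 :
    ∃ C : ℝ, 0 < C ∧
      ∀ (ε δ : ℝ) (f : ℕ), 0 < ε → ε < 1 → 0 < δ → δ < 1 → 1 ≤ f →
      ∀ (d k : ℕ), C * Real.log (f / δ) / ε ^ 2 ≤ k →
      ∀ V : Finset (EuclideanSpace ℝ (Fin d)), V.card = f →
        ENNReal.ofReal (1 - δ) ≤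
          gaussianMatrix k d
            {P | ∀ v ∈ V, ∀ v' ∈ V,
              |⟪Matrix.toEuclideanLin (Matrix.of P) v,
                  Matrix.toEuclideanLin (Matrix.of P) v'⟫ - ⟪v, v'⟫| ≤
                ε * ‖v‖ * ‖v'‖} := by
  refine ⟨50000 * Real.exp 42, by positivity, fun ε δ f hε hε' hδ hδ' hf d k hk V hV => ?_⟩
  change _ ≤ gaussianMatrix k d (jlSet k ε V)
  rw [ENNReal.ofReal_le_iff_le_toReal (measure_ne_top _ _), ← measureReal_def]
  have hf' : (1 : ℝ) ≤ f := by exact_mod_cast hf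
  have hfδ : 1 < f / δ := by rw [lt_div_iff₀ hδ]; linarith
  have hlog : 0 < Real.log (f / δ) := Real.log_pos hfδ
  have hk1 : 1 ≤ k := by
    have : (0 : ℝ) < k := lt_of_lt_of_le (by positivity) hk
    exact_mod_cast this
  rw [div_le_iff₀ (by positivity)] at hk
  by_cases hcase : f = 1 ∧ 1 / 2 < δ
  · obtain ⟨rfl, hδ₂⟩ := hcase
    obtain ⟨v, rfl⟩ := Finset.card_eq_one.1 hV
    refine one_sub_le_gaussianMatrix_real_jlSet_singleton hk1 hε hε' hδ₂ (le_trans ?_ hk) v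
    have := Real.one_sub_inv_le_log_of_pos (by positivity : 0 < ((1 : ℕ) : ℝ) / δ)
    rw [inv_div, Nat.cast_one, div_one] at this
    gcongr
    exact_mod_cast this
  · refine le_trans ?_ (one_sub_le_gaussianMatrix_real_jlSet hk1 hε hε' V)
    rw [hV]
    have h5 : 5 * Real.log (f / δ) ≤ k * ε ^ 2 / 16 := by
      have := Real.one_le_exp (by norm_num : (0 : ℝ) ≤ 42)
      nlinarith
    have hexp : Real.exp (-(k * ε ^ 2 / 16)) ≤ (δ / f) ^ 5 := by
      refine (Real.exp_le_exp.2 (neg_le_neg h5)).trans (le_of_eq ?_)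
      rw [← inv_div, Real.log_inv, mul_neg, neg_neg, show (5 : ℝ) = (5 : ℕ) by norm_num,
        Real.exp_nat_mul, Real.exp_log (by positivity)]
    have hmain : 4 * δ ^ 4 ≤ f ^ 3 := by
      rcases eq_or_lt_of_le hf with hf1 | hf2
      · have hδ₂ : δ ≤ 1 / 2 := by
          by_contra! h
          exact hcase ⟨hf1.symm, h⟩
        have : δ ^ 4 ≤ (1 / 2) ^ 4 := by gcongr
        have : (1 : ℝ) ≤ f ^ 3 := one_le_pow₀ hf'
        linarith
      · have h2 : (2 : ℝ) ≤ f := by exact_mod_cast hf2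
        have : (2 : ℝ) ^ 3 ≤ f ^ 3 := by gcongr
        have : δ ^ 4 ≤ 1 := pow_le_one₀ hδ.le hδ'.le
        linarith
    have : 4 * (f : ℝ) ^ 2 * (δ / f) ^ 5 ≤ δ := by
      have : 4 * (f : ℝ) ^ 2 * (δ / f) ^ 5 = δ * (4 * δ ^ 4) / f ^ 3 := by field_simp
      rw [this, div_le_iff₀ (by positivity)]
      gcongr
    have := mul_le_mul_of_nonneg_left hexp (by positivity : 0 ≤ 4 * (f : ℝ) ^ 2)
    linarith
end
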